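/- arXiv:2007.08324 — 2 statements merged into one kernel-verified Lean document; each statement's English description precedes it below -/
import Mathlib

section
/- Every (12k−7)-edge-connected graph with an even number of vertices has a spanning subgraph in which every vertex has degree congruent to k modulo 2k. -/
/-- `G` is `m`-edge-connected: removing any `m − 1` edges leaves it connected. -/
def IsMEdgeConnected {V : Type*} (G : SimpleGraph V) (m : ℕ) : Prop :=
  ∀ F : Finset (Sym2 V), F.card ≤ m - 1 → (G.deleteEdges (↑F : Set (Sym2 V))).Connected

/-- The distance from `z` to the nearest multiple of `2 * m`. -/
def modNorm (m : ℕ) (z : ℤ) : ℤ := |Int.bmod z (2 * m)|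

section modNorm

variable {m : ℕ}

lemma modNorm_nonneg (z : ℤ) : 0 ≤ modNorm m z := abs_nonneg _

lemma exists_modNorm_eq (m : ℕ) (z : ℤ) : ∃ t : ℤ, modNorm m z = |z - 2 * m * t| := by
  refine ⟨Int.bdiv z (2 * m), ?_⟩
  have h := Int.bmod_add_bdiv z (2 * m)
  push_cast at h
  rw [modNorm]
  congr 1
  linarith

lemma modNorm_le (hm : 0 < m) (z : ℤ) : modNorm m z ≤ m := by
  have h1 := Int.le_bmod (x := z) (m := 2 * m) (by omega)
  have h2 := Int.bmod_lt (x := z) (m := 2 * m) (by omega)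
  rw [modNorm, abs_le]
  push_cast at h1 h2
  constructor <;> omega

lemma modNorm_le_abs_sub (hm : 0 < m) (z t : ℤ) : modNorm m z ≤ |z - 2 * m * t| := by
  obtain ⟨s, hs⟩ := exists_modNorm_eq m z
  have hle := modNorm_le hm z
  rcases eq_or_ne s t with rfl | hst
  · exact hs.le
  · have h1 : (1 : ℤ) ≤ |s - t| := Int.one_le_abs (sub_ne_zero.2 hst)
    have h2 : |2 * (m : ℤ) * (s - t)| = 2 * m * |s - t| := by
      rw [abs_mul, abs_of_nonneg (by positivity)]
    have h3 : |2 * (m : ℤ) * (s - t)| ≤ |z - 2 * m * t| + |z - 2 * m * s| := by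
      have : 2 * (m : ℤ) * (s - t) = (z - 2 * m * t) - (z - 2 * m * s) := by ring
      rw [this]; exact abs_sub _ _
    nlinarith

lemma modNorm_le_abs (hm : 0 < m) (z : ℤ) : modNorm m z ≤ |z| := by
  simpa using modNorm_le_abs_sub hm z 0

lemma modNorm_add_le (hm : 0 < m) (a b : ℤ) : modNorm m (a + b) ≤ modNorm m a + modNorm m b := by
  obtain ⟨s, hs⟩ := exists_modNorm_eq m a
  obtain ⟨t, ht⟩ := exists_modNorm_eq m b
  refine (modNorm_le_abs_sub hm _ (s + t)).trans ?_
  rw [hs, ht]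
  have : a + b - 2 * m * (s + t) = (a - 2 * m * s) + (b - 2 * m * t) := by ring
  rw [this]
  exact abs_add_le _ _

lemma modNorm_add_le_abs (hm : 0 < m) (a b : ℤ) : modNorm m (a + b) ≤ modNorm m a + |b| :=
  (modNorm_add_le hm a b).trans (by gcongr; exact modNorm_le_abs hm b)

lemma modNorm_congr (hm : 0 < m) {a b : ℤ} (h : 2 * (m : ℤ) ∣ a - b) :
    modNorm m a = modNorm m b := by
  have key : ∀ {a b : ℤ}, 2 * (m : ℤ) ∣ a - b → modNorm m a ≤ modNorm m b := by
    rintro a b ⟨c, hc⟩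
    obtain ⟨t, ht⟩ := exists_modNorm_eq m b
    rw [ht]
    refine (modNorm_le_abs_sub hm a (t + c)).trans_eq ?_
    congr 1
    linarith
  exact le_antisymm (key h) (key (by rw [← neg_sub]; exact h.neg_right))

lemma modNorm_neg (hm : 0 < m) (a : ℤ) : modNorm m (-a) = modNorm m a := by
  have key : ∀ a : ℤ, modNorm m (-a) ≤ modNorm m a := fun a ↦ by
    obtain ⟨t, ht⟩ := exists_modNorm_eq m a
    rw [ht, ← abs_neg]
    refine (modNorm_le_abs_sub hm (-a) (-t)).trans_eq ?_
    congr 1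
    ring
  exact le_antisymm (key a) (by simpa using key (-a))

lemma two_dvd_modNorm_sub (z : ℤ) : 2 ∣ modNorm m z - z := by
  obtain ⟨t, ht⟩ := exists_modNorm_eq m z
  rw [ht]
  have h : 2 * (m : ℤ) * t = 2 * (m * t) := by ring
  rw [h]
  generalize (m : ℤ) * t = u
  rw [abs_eq_max_neg]
  omega

lemma modNorm_of_abs_le (hm : 0 < m) {z : ℤ} (h : |z| ≤ m) : modNorm m z = |z| := by
  refine le_antisymm (modNorm_le_abs hm z) ?_
  obtain ⟨t, ht⟩ := exists_modNorm_eq m z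
  rw [ht]
  rcases eq_or_ne t 0 with rfl | h0
  · simp
  · have h1 := Int.one_le_abs h0
    have h2 : |2 * (m : ℤ) * t| = 2 * m * |t| := by
      rw [abs_mul, abs_of_nonneg (by positivity)]
    have h3 : |2 * (m : ℤ) * t| ≤ |z| + |z - 2 * m * t| := by
      have : 2 * (m : ℤ) * t = z - (z - 2 * m * t) := by ring
      conv_lhs => rw [this]
      exact abs_sub _ _
    nlinarith

/-- A symmetric representative of `z` modulo `2 * m` of absolute value `modNorm m z`. -/
lemma exists_repr (m : ℕ) (z : ℤ) : ∃ r : ℤ, 2 * (m : ℤ) ∣ z - r ∧ modNorm m z = |r| := by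
  obtain ⟨t, ht⟩ := exists_modNorm_eq m z
  exact ⟨z - 2 * m * t, ⟨t, by ring⟩, ht⟩

lemma modNorm_sub_one_or_add_one (hm : 0 < m) {z : ℤ} (hz : ¬ 2 * (m : ℤ) ∣ z) :
    modNorm m (z - 1) = modNorm m z - 1 ∨ modNorm m (z + 1) = modNorm m z - 1 := by
  obtain ⟨r, hr, hn⟩ := exists_repr m z
  have hle := modNorm_le hm z
  rw [hn] at hle ⊢
  have hr0 : r ≠ 0 := by rintro rfl; simp at hr; exact hz hr
  rcases lt_or_gt_of_ne hr0 with h | h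
  · right
    rw [modNorm_congr hm (b := r + 1) (by simpa using hr), modNorm_of_abs_le hm] <;>
      simp only [abs_eq_max_neg] at * <;> omega
  · left
    rw [modNorm_congr hm (b := r - 1) (by simpa using hr), modNorm_of_abs_le hm] <;>
      simp only [abs_eq_max_neg] at * <;> omega

/-- A value `z` for which adding `1` increases the norm is congruent to its norm. -/
lemma modNorm_add_one_eq_imp (hm : 0 < m) {z : ℤ} (hz : ¬ 2 * (m : ℤ) ∣ z)
    (h : modNorm m (z + 1) = modNorm m z + 1) : 0 < modNorm m z ∧ modNorm m z < m ∧
      2 * (m : ℤ) ∣ z - modNorm m z := by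
  obtain ⟨r, hr, hn⟩ := exists_repr m z
  have h1 := modNorm_le hm (z + 1)
  have h2 : modNorm m (z + 1) ≤ |r + 1| := by
    rw [modNorm_congr hm (b := r + 1) (by simpa using hr)]
    exact modNorm_le_abs hm _
  have h3 : r ≠ 0 := by rintro rfl; exact hz (by simpa using hr)
  rw [hn] at h ⊢
  have h4 : 0 < r := by
    rw [h] at h2
    simp only [abs_eq_max_neg] at h2
    omega
  rw [abs_of_pos h4] at h ⊢
  exact ⟨h4, by omega, hr⟩

end modNorm

section Orientation

open Finset

variable {ι : Type*} {m : ℕ} {S X : Finset ι} {e : ι → ι → ℤ} {p q β : ι → ℤ}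

/-- The orientation at the root extends to one in which every `x ∈ S` has outdegree
minus indegree congruent to `β x` modulo `2 * m`; here `f x y` is the number of edges
oriented from `x` to `y`. -/
def Orientable (m : ℕ) (S : Finset ι) (e : ι → ι → ℤ) (p q β : ι → ℤ) : Prop :=
  ∃ f : ι → ι → ℤ, (∀ x ∈ S, ∀ y ∈ S, x ≠ y → 0 ≤ f x y ∧ f x y + f y x = e x y) ∧
    ∀ x ∈ S, 2 * (m : ℤ) ∣ ∑ y ∈ S, (f x y - f y x) + q x - p x - β x

lemma Orientable.of_swap (h : Orientable m S e q p (fun x ↦ - β x)) (hsymm : ∀ x y, e x y = e y x) :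
    Orientable m S e p q β := by
  obtain ⟨f, h1, h2⟩ := h
  refine ⟨fun x y ↦ f y x, fun x hx y hy hxy ↦ ?_, fun x hx ↦ ?_⟩
  · have := h1 y hy x hx hxy.symm
    rw [hsymm x y]
    exact this
  · have h3 : ∑ y ∈ S, (f y x - f x y) + q x - p x - β x =
        -(∑ y ∈ S, (f x y - f y x) + p x - q x - -β x) := by
      rw [sum_sub_distrib, sum_sub_distrib]
      ring
    rw [h3]
    exact Int.dvd_neg.2 (h2 x hx)

/-- Transfer of an orientation along a modification of the multigraph. -/
lemma Orientable.modify {e' : ι → ι → ℤ} {p' q' β' : ι → ℤ} (h' : Orientable m S e' p' q' β')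
    (hh : ∀ f' : ι → ι → ℤ,
      (∀ x ∈ S, ∀ y ∈ S, x ≠ y → 0 ≤ f' x y ∧ f' x y + f' y x = e' x y) →
      ∃ g : ι → ι → ℤ, (∀ x ∈ S, ∀ y ∈ S, x ≠ y → 0 ≤ f' x y + g x y) ∧
        (∀ x ∈ S, ∀ y ∈ S, x ≠ y → e' x y + g x y + g y x = e x y) ∧
        ∀ x ∈ S, ∑ y ∈ S, (g x y - g y x) + (q x - q' x) - (p x - p' x) - (β x - β' x) = 0) :
    Orientable m S e p q β := by
  obtain ⟨f', h1, h2⟩ := h'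
  obtain ⟨g, g1, g2, g3⟩ := hh f' h1
  refine ⟨fun x y ↦ f' x y + g x y, fun x hx y hy hxy ↦ ⟨g1 x hx y hy hxy, ?_⟩, fun x hx ↦ ?_⟩
  · have := (h1 x hx y hy hxy).2
    have := g2 x hx y hy hxy
    linarith
  · convert h2 x hx using 1
    have := g3 x hx
    have e1 : ∑ y ∈ S, (f' x y + g x y - (f' y x + g y x)) =
        ∑ y ∈ S, (f' x y - f' y x) + ∑ y ∈ S, (g x y - g y x) := by
      rw [← sum_add_distrib]; exact sum_congr rfl fun y _ ↦ by ring
    rw [e1]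
    linarith

variable [DecidableEq ι]

/-- An integer between `0` and `∑ x ∈ A, c x` splits into parts bounded by the `c x`. -/
lemma exists_sum_eq_of_le {A : Finset ι} {c : ι → ℤ} (hc : ∀ x, 0 ≤ c x) {t : ℤ} (ht : 0 ≤ t)
    (hle : t ≤ ∑ x ∈ A, c x) : ∃ g : ι → ℤ, (∀ x, 0 ≤ g x ∧ g x ≤ c x) ∧ ∑ x ∈ A, g x = t := by
  induction A using Finset.induction_on generalizing t with
  | empty =>
    simp only [sum_empty] at hle ⊢
    exact ⟨fun _ ↦ 0, fun x ↦ ⟨le_rfl, hc x⟩, by omega⟩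
  | insert a A ha ih =>
    rw [sum_insert ha] at hle
    have h1 := hc a
    obtain ⟨g, hg, hsum⟩ := ih (t := t - min t (c a)) (by omega) (by
      have : 0 ≤ ∑ x ∈ A, c x := sum_nonneg fun x _ ↦ hc x
      omega)
    refine ⟨fun x ↦ if x = a then min t (c a) else g x, fun x ↦ ?_, ?_⟩
    · by_cases hx : x = a
      · subst hx; simp only [if_true]; omega
      · simp only [hx, if_false]; exact hg x
    · rw [sum_insert ha, if_pos rfl, sum_congr rfl fun x hx ↦ if_neg (ne_of_mem_of_not_mem hx ha),
        hsum]
      ring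

/-- The degree of a vertex set `A ⊆ S` in the multigraph on `S` together with a root, where `e` is
the edge multiplicity inside `S` and `w` the number of edges to the root. -/
def cut (S : Finset ι) (e : ι → ι → ℤ) (w : ι → ℤ) (A : Finset ι) : ℤ :=
  ∑ x ∈ A, w x + ∑ x ∈ A, ∑ y ∈ S \ A, e x y

/-- A multigraph on `S` together with a root, whose edges at the root are oriented (`p x` edges
from the root to `x` and `q x` edges from `x` to the root), and prescribed values `β` of
outdegree minus indegree modulo `2 * m`, subject to degree conditions which ensure that
the orientation extends. The set `X` holds at most one vertex, exempt from its degree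
condition. -/
structure Admissible (m : ℕ) (S X : Finset ι) (e : ι → ι → ℤ) (p q β : ι → ℤ) : Prop where
  symm : ∀ x y, e x y = e y x
  e_nonneg : ∀ x y, 0 ≤ e x y
  p_nonneg : ∀ x, 0 ≤ p x
  q_nonneg : ∀ x, 0 ≤ q x
  card_le : X.card ≤ 1
  dvd_of_mem : ∀ x ∈ X, 2 * (m : ℤ) ∣ β x
  two_le : 2 ≤ S.card
  parity : ∀ A ⊆ S, 2 ∣ cut S e (fun x ↦ p x + q x) A - ∑ x ∈ A, β x
  sum_dvd : 2 * (m : ℤ) ∣ ∑ x ∈ S, (β x + p x - q x)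
  root_le : ∑ x ∈ S, (p x + q x) ≤ 2 * m - 2 + modNorm m (∑ x ∈ S, (p x - q x))
  le_cut : ∀ A ⊆ S, A.Nonempty → A ≠ S → A ≠ X →
    2 * m - 2 + modNorm m (∑ x ∈ A, β x) ≤ cut S e (fun x ↦ p x + q x) A

/-- Vertex sets which are not singletons exceed their degree condition by `2`. -/
def Slack (m : ℕ) (S : Finset ι) (e : ι → ι → ℤ) (p q β : ι → ℤ) : Prop :=
  ∀ A ⊆ S, 2 ≤ A.card → A ≠ S →
    2 * m + modNorm m (∑ x ∈ A, β x) ≤ cut S e (fun x ↦ p x + q x) A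

/-- The indicator function of `a`. -/
def ind (a u : ι) : ℤ := if u = a then 1 else 0

/-- The multiplicity function of a single edge `ab`. -/
def edgeInd (a b u v : ι) : ℤ := ind a u * ind b v + ind b u * ind a v

lemma sum_ind (A : Finset ι) (a : ι) : ∑ u ∈ A, ind a u = if a ∈ A then 1 else 0 := by
  simp [ind]

lemma sum_edgeInd (A B : Finset ι) (a b : ι) : ∑ u ∈ A, ∑ v ∈ B, edgeInd a b u v =
    (if a ∈ A then 1 else 0) * (if b ∈ B then 1 else 0) +
      (if b ∈ A then 1 else 0) * (if a ∈ B then 1 else 0) := by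
  simp only [edgeInd, sum_add_distrib, ← mul_sum, ← sum_mul, sum_ind]

lemma cut_congr {S A : Finset ι} {e e' : ι → ι → ℤ} {w w' : ι → ℤ}
    (he : ∀ u v, e u v = e' u v) (hw : ∀ u, w u = w' u) : cut S e w A = cut S e' w' A := by
  simp only [cut, he, hw]

lemma ind_nonneg (a u : ι) : 0 ≤ ind a u := by unfold ind; split_ifs <;> simp

lemma edgeInd_comm (a b u v : ι) : edgeInd a b u v = edgeInd a b v u := by
  simp only [edgeInd]; ring

lemma Admissible.swap (h : Admissible m S X e p q β) (hm : 0 < m) :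
    Admissible m S X e q p (fun x ↦ - β x) where
  symm := h.symm
  e_nonneg := h.e_nonneg
  p_nonneg := h.q_nonneg
  q_nonneg := h.p_nonneg
  card_le := h.card_le
  dvd_of_mem x hx := (h.dvd_of_mem x hx).neg_right
  two_le := h.two_le
  parity A hA := by
    have := h.parity A hA
    rw [cut_congr (fun _ _ ↦ rfl) (fun u ↦ add_comm (q u) (p u)), sum_neg_distrib]
    omega
  sum_dvd := by
    have := h.sum_dvd.neg_right
    rw [← sum_neg_distrib] at this
    simpa only [neg_sub, neg_add, sub_eq_add_neg, neg_neg, add_right_comm] using this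
  root_le := by
    have := h.root_le
    rw [← modNorm_neg hm, ← sum_neg_distrib]
    simpa [add_comm] using this
  le_cut A hA h1 h2 h3 := by
    rw [cut_congr (fun _ _ ↦ rfl) (fun u ↦ add_comm (q u) (p u)), sum_neg_distrib, modNorm_neg hm]
    exact h.le_cut A hA h1 h2 h3

lemma Slack.swap (h : Slack m S e p q β) (hm : 0 < m) : Slack m S e q p (fun x ↦ - β x) := by
  intro A hA h1 h2
  rw [cut_congr (fun _ _ ↦ rfl) (fun u ↦ add_comm (q u) (p u)), sum_neg_distrib, modNorm_neg hm]
  exact h A hA h1 h2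

/-- Deleting an edge `xy` which is to be oriented from `x` to `y`. -/
lemma Admissible.orientable_of_delete_edge (hm : 0 < m) (h : Admissible m S ∅ e p q β)
    (hs : Slack m S e p q β)
    (ih : ∀ X' e' p' q' β', ∑ x ∈ S, ∑ y ∈ S, e' x y < ∑ x ∈ S, ∑ y ∈ S, e x y →
      Admissible m S X' e' p' q' β' → Orientable m S e' p' q' β')
    {x y : ι} (hx : x ∈ S) (hy : y ∈ S) (hxy : x ≠ y) (he : 0 < e x y)
    (hcx : 2 * m - 1 + modNorm m (β x - 1) ≤ cut S e (fun x ↦ p x + q x) {x})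
    (hcy : 2 * m - 1 + modNorm m (β y + 1) ≤ cut S e (fun x ↦ p x + q x) {y}) :
    Orientable m S e p q β := by
  have hcut : ∀ A ⊆ S, cut S (fun u v ↦ e u v - edgeInd x y u v) (fun x ↦ p x + q x) A =
      cut S e (fun x ↦ p x + q x) A - (if x ∈ A then if y ∈ A then 0 else 1 else
        if y ∈ A then 1 else 0) := by
    intro A hA
    simp only [cut, sum_sub_distrib, sum_edgeInd, mem_sdiff, hx, hy, true_and]
    split_ifs <;> simp_all <;> ring
  have hβ : ∀ A : Finset ι, ∑ u ∈ A, (β u - ind x u + ind y u) =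
      ∑ u ∈ A, β u - (if x ∈ A then 1 else 0) + (if y ∈ A then 1 else 0) := by
    intro A
    simp only [sum_add_distrib, sum_sub_distrib, sum_ind]
  have key : Admissible m S ∅ (fun u v ↦ e u v - edgeInd x y u v) p q
      (fun u ↦ β u - ind x u + ind y u) := by
    refine ⟨fun u v ↦ ?_, fun u v ↦ ?_, h.p_nonneg, h.q_nonneg, by simp, by simp, h.two_le,
      fun A hA ↦ ?_, ?_, h.root_le, fun A hA hne hAS _ ↦ ?_⟩
    · rw [h.symm, edgeInd_comm]
    · have h1 := h.e_nonneg u v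
      have h2 := h.symm x y
      unfold edgeInd ind
      split_ifs <;> subst_vars <;> simp <;> first | omega | simp_all
    · have := h.parity A hA
      rw [hcut A hA, hβ]
      split_ifs <;> omega
    · have : ∑ u ∈ S, (β u - ind x u + ind y u + p u - q u) =
        ∑ u ∈ S, (β u + p u - q u) + ∑ u ∈ S, (ind y u - ind x u) := by
        rw [← sum_add_distrib]; exact sum_congr rfl fun y _ ↦ by ring
      rw [this, sum_sub_distrib (ind y) (ind x), sum_ind, sum_ind, if_pos hx, if_pos hy, sub_self,
        add_zero]
      exact h.sum_dvd
    · rw [hcut A hA, hβ]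
      have h0 := h.le_cut A hA hne hAS hne.ne_empty
      by_cases hA2 : 2 ≤ A.card
      · have h1 := hs A hA hA2 hAS
        have h2 := modNorm_add_le_abs hm (∑ u ∈ A, β u) 1
        have h3 := modNorm_add_le_abs hm (∑ u ∈ A, β u) (-1)
        rw [← sub_eq_add_neg] at h3
        simp only [abs_neg, abs_one] at h2 h3
        split_ifs <;> simp <;> omega
      · obtain ⟨a, rfl⟩ := card_eq_one.1
          (show A.card = 1 by have := hne.card_pos; omega)
        simp only [mem_singleton, sum_singleton] at h0 ⊢
        by_cases hxa : x = a
        · subst hxa; simp [hxy.symm]; omega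
        · by_cases hya : y = a
          · subst hya; simp [hxy]; omega
          · simp [hxa, hya]; omega
  refine (ih _ _ _ _ _ ?_ key).modify fun f' _ ↦
    ⟨fun u v ↦ ind x u * ind y v, fun u hu v hv huv ↦ ?_, fun u hu v hv huv ↦ ?_, fun u hu ↦ ?_⟩
  · simp only [sum_sub_distrib, sum_edgeInd, hx, hy]
    simp
  · have := ind_nonneg x u; have := ind_nonneg y v
    have : 0 ≤ f' u v := by aesop
    positivity
  · simp only [edgeInd]; ring
  · simp only [sum_sub_distrib, ← mul_sum, ← sum_mul, sum_ind, hx, hy]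
    simp
    ring

/-- Deleting an edge from `x` to the root. -/
lemma Admissible.orientable_of_delete_arc (hm : 0 < m) (h : Admissible m S ∅ e p q β)
    (hs : Slack m S e p q β)
    (ih : ∀ p' q' β', ∑ x ∈ S, (p' x + q' x) < ∑ x ∈ S, (p x + q x) →
      Admissible m S ∅ e p' q' β' → Orientable m S e p' q' β')
    {x : ι} (hx : x ∈ S) (hq : 0 < q x)
    (hcx : 2 * m - 1 + modNorm m (β x - 1) ≤ cut S e (fun x ↦ p x + q x) {x}) :
    Orientable m S e p q β := by
  have hcut : ∀ A ⊆ S, cut S e (fun u ↦ p u + (q u - ind x u)) A =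
      cut S e (fun x ↦ p x + q x) A - if x ∈ A then 1 else 0 := by
    intro A hA
    simp only [cut, sum_add_distrib, sum_sub_distrib, sum_ind]
    ring
  have hβ : ∀ A : Finset ι, ∑ u ∈ A, (β u - ind x u) =
      ∑ u ∈ A, β u - if x ∈ A then 1 else 0 := by
    intro A
    simp only [sum_sub_distrib, sum_ind]
  have key : Admissible m S ∅ e p (fun u ↦ q u - ind x u) (fun u ↦ β u - ind x u) := by
    refine ⟨h.symm, h.e_nonneg, h.p_nonneg, fun u ↦ ?_, by simp, by simp, h.two_le,
      fun A hA ↦ ?_, ?_, ?_, fun A hA hne hAS _ ↦ ?_⟩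
    · have h1 := h.q_nonneg u
      unfold ind
      split_ifs with hu
      · subst hu; omega
      · omega
    · have := h.parity A hA
      rw [hcut A hA, hβ]
      split_ifs <;> omega
    · convert h.sum_dvd using 1
      exact sum_congr rfl fun u _ ↦ by ring
    · have h1 := h.root_le
      have h2 : ∑ u ∈ S, (p u - (q u - ind x u)) = ∑ u ∈ S, (p u - q u) + 1 := by
        simp only [sum_sub_distrib, sum_ind, if_pos hx]; ring
      have h3 : ∑ u ∈ S, (p u + (q u - ind x u)) = ∑ u ∈ S, (p u + q u) - 1 := by
        simp only [sum_sub_distrib, sum_add_distrib, sum_ind, if_pos hx]; ring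
      have h4 := modNorm_add_le_abs hm (∑ u ∈ S, (p u - q u) + 1) (-1)
      rw [h2, h3]
      simp only [abs_neg, abs_one, add_neg_cancel_right] at h4
      linarith
    · rw [hcut A hA, hβ]
      have h0 := h.le_cut A hA hne hAS hne.ne_empty
      by_cases hA2 : 2 ≤ A.card
      · have h1 := hs A hA hA2 hAS
        have h3 := modNorm_add_le_abs hm (∑ u ∈ A, β u) (-1)
        rw [← sub_eq_add_neg] at h3
        simp only [abs_neg, abs_one] at h3
        split_ifs <;> simp <;> omega
      · obtain ⟨a, rfl⟩ := card_eq_one.1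
          (show A.card = 1 by have := hne.card_pos; omega)
        simp only [mem_singleton, sum_singleton] at h0 ⊢
        by_cases hxa : x = a
        · subst hxa; simp; omega
        · simp [hxa]; omega
  refine (ih _ _ _ ?_ key).modify fun f' hf' ↦
    ⟨fun u v ↦ 0, fun u hu v hv huv ↦ ?_, fun u hu v hv huv ↦ ?_, fun u hu ↦ ?_⟩
  · simp only [sum_sub_distrib, sum_add_distrib, sum_ind, if_pos hx]
    omega
  · simpa using (hf' u hu v hv huv).1
  · simp
  · simp

lemma cut_add_arcs (S A : Finset ι) (e : ι → ι → ℤ) (p q : ι → ℤ) (x : ι) (c : ℤ) :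
    cut S e (fun u ↦ p u + (q u + c * ind x u)) A =
      cut S e (fun x ↦ p x + q x) A + if x ∈ A then c else 0 := by
  simp only [cut, sum_add_distrib, ← mul_sum, sum_ind, mul_ite, mul_one, mul_zero]
  ring

lemma sum_add_mul_ind (A : Finset ι) (β : ι → ℤ) (x : ι) (c : ℤ) :
    ∑ u ∈ A, (β u + c * ind x u) = ∑ u ∈ A, β u + if x ∈ A then c else 0 := by
  simp only [sum_add_distrib, ← mul_sum, sum_ind, mul_ite, mul_one, mul_zero]

/-- Adding `c` edges from `x` to the root. -/
lemma Admissible.add_arcs (hm : 0 < m) (h : Admissible m S ∅ e p q β) {x : ι} (hx : x ∈ S)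
    {c : ℤ} (hc : 0 ≤ c)
    (hr : ∑ x ∈ S, (p x + q x) + c ≤ 2 * m - 2 + modNorm m (∑ x ∈ S, (p x - q x) - c)) :
    Admissible m S ∅ e p (fun u ↦ q u + c * ind x u) (fun u ↦ β u + c * ind x u) := by
  refine ⟨h.symm, h.e_nonneg, h.p_nonneg, fun u ↦ ?_, by simp, by simp, h.two_le,
      fun A hA ↦ ?_, ?_, ?_, fun A hA hne hAS _ ↦ ?_⟩
  · have h1 := h.q_nonneg u
    have := mul_nonneg hc (ind_nonneg x u)
    omega
  · have := h.parity A hA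
    rw [cut_add_arcs, sum_add_mul_ind]
    split_ifs <;> omega
  · convert h.sum_dvd using 1
    exact sum_congr rfl fun u _ ↦ by ring
  · convert hr using 3
    · simp only [sum_add_distrib, ← mul_sum, sum_ind, if_pos hx]; ring
    · simp only [sum_sub_distrib, sum_add_distrib, ← mul_sum, sum_ind, if_pos hx]; ring
  · rw [cut_add_arcs, sum_add_mul_ind]
    have h0 := h.le_cut A hA hne hAS hne.ne_empty
    have h3 := modNorm_add_le_abs hm (∑ u ∈ A, β u) c
    rw [abs_of_nonneg hc] at h3
    split_ifs <;> simp <;> omega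

lemma Slack.add_arcs (hm : 0 < m) (hs : Slack m S e p q β) {x : ι} {c : ℤ} (hc : 0 ≤ c) :
    Slack m S e p (fun u ↦ q u + c * ind x u) (fun u ↦ β u + c * ind x u) := by
  intro A hA hA2 hAS
  rw [cut_add_arcs, sum_add_mul_ind]
  have h0 := hs A hA hA2 hAS
  have h3 := modNorm_add_le_abs hm (∑ u ∈ A, β u) c
  rw [abs_of_nonneg hc] at h3
  split_ifs <;> simp <;> omega

lemma Orientable.of_add_arcs {x : ι} {c : ℤ}
    (h : Orientable m S e p (fun u ↦ q u + c * ind x u) (fun u ↦ β u + c * ind x u)) :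
    Orientable m S e p q β :=
  h.modify fun f' hf' ↦ ⟨fun _ _ ↦ 0, fun u hu v hv huv ↦ by simpa using (hf' u hu v hv huv).1,
    by simp, by simp⟩

/-- The edges inside `S` connect any proper part of `S` to the rest. -/
lemma Admissible.exists_edge (hm : 2 ≤ m) (h : Admissible m S ∅ e p q β) {A : Finset ι}
    (hA : A ⊆ S) (hne : A.Nonempty) (hAS : A ≠ S) : ∃ x ∈ A, ∃ y ∈ S \ A, 0 < e x y := by
  by_contra! hno
  have h0 : ∀ x ∈ A, ∀ y ∈ S \ A, e x y = 0 := fun x hx y hy ↦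
    le_antisymm (hno x hx y hy) (h.e_nonneg x y)
  have hne' : (S \ A).Nonempty := by
    rw [sdiff_nonempty]; exact fun hSA ↦ hAS (hA.antisymm hSA)
  have hne2 : S \ A ≠ S := by
    intro heq
    obtain ⟨a, ha⟩ := hne
    have := heq.symm ▸ hA ha
    exact (mem_sdiff.1 this).2 ha
  have h1 := h.le_cut A hA hne hAS hne.ne_empty
  have h2 := h.le_cut (S \ A) sdiff_subset hne' hne2 hne'.ne_empty
  have h3 := h.root_le
  have e1 : cut S e (fun x ↦ p x + q x) A = ∑ x ∈ A, (p x + q x) := by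
    rw [cut, add_eq_left]
    exact sum_eq_zero fun x hx ↦ sum_eq_zero fun y hy ↦ h0 x hx y hy
  have e2 : cut S e (fun x ↦ p x + q x) (S \ A) = ∑ x ∈ S \ A, (p x + q x) := by
    rw [cut, add_eq_left, Finset.sdiff_sdiff_eq_self hA]
    exact sum_eq_zero fun x hx ↦ sum_eq_zero fun y hy ↦ by rw [h.symm]; exact h0 y hy x hx
  have e3 := sum_sdiff hA (f := fun x ↦ p x + q x)
  have e4 := sum_sdiff hA (f := β)
  have e5 : modNorm m (∑ x ∈ S, (p x - q x)) = modNorm m (∑ x ∈ S, β x) := by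
    rw [← modNorm_neg (by omega)]
    refine modNorm_congr (by omega) ?_
    have := Int.dvd_neg.2 h.sum_dvd
    convert this using 1
    simp only [sum_sub_distrib, sum_add_distrib]
    ring
  have e6 := modNorm_add_le (m := m) (by omega) (∑ x ∈ S \ A, β x) (∑ x ∈ A, β x)
  rw [e4] at e6
  have : (2 : ℤ) ≤ m := by exact_mod_cast hm
  linarith

/-- Lifting an edge from the root to the exempt vertex `v` and an edge `vy`. -/
lemma Admissible.orientable_of_lift_arc {v : ι} (h : Admissible m S {v} e p q β)
    (hs : Slack m S e p q β)
    (ih : ∀ X' e' p' q' β', ∑ x ∈ S, ∑ y ∈ S, e' x y < ∑ x ∈ S, ∑ y ∈ S, e x y →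
      Admissible m S X' e' p' q' β' → Orientable m S e' p' q' β')
    {y : ι} (hv : v ∈ S) (hy : y ∈ S) (hvy : v ≠ y) (he : 0 < e v y) (hp : 0 < p v) :
    Orientable m S e p q β := by
  have hcut : ∀ A ⊆ S, cut S (fun a b ↦ e a b - edgeInd v y a b)
      (fun u ↦ p u - ind v u + ind y u + q u) A =
      cut S e (fun x ↦ p x + q x) A - if v ∈ A then if y ∈ A then 0 else 2 else 0 := by
    intro A hA
    simp only [cut, sum_add_distrib, sum_sub_distrib, sum_edgeInd, mem_sdiff, hv, hy, true_and,
      sum_ind]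
    split_ifs <;> simp_all <;> ring
  have key : Admissible m S {v} (fun a b ↦ e a b - edgeInd v y a b)
      (fun u ↦ p u - ind v u + ind y u) q β := by
    refine ⟨fun a b ↦ ?_, fun a b ↦ ?_, fun a ↦ ?_, h.q_nonneg, h.card_le, h.dvd_of_mem, h.two_le,
      fun A hA ↦ ?_, ?_, ?_, fun A hA hne hAS hAX ↦ ?_⟩
    · rw [h.symm, edgeInd_comm]
    · have h1 := h.e_nonneg a b
      have h2 := h.symm v y
      unfold edgeInd ind
      split_ifs <;> subst_vars <;> simp <;> first | omega | simp_all
    · have h1 := h.p_nonneg a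
      have h2 := ind_nonneg y a
      by_cases hav : a = v
      · subst hav; simp [ind, hvy]; omega
      · have h3 : ind v a = 0 := by simp [ind, hav]
        show 0 ≤ p a - ind v a + ind y a
        omega
    · have := h.parity A hA
      rw [hcut A hA]
      split_ifs <;> omega
    · convert h.sum_dvd using 1
      simp only [sum_add_distrib, sum_sub_distrib, sum_ind, hv, hy]
      simp
    · have h1 : ∑ u ∈ S, (p u - ind v u + ind y u + q u) = ∑ u ∈ S, (p u + q u) := by
        simp only [sum_add_distrib, sum_sub_distrib, sum_ind, hv, hy, if_true, sub_add_cancel]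
      have h2 : ∑ u ∈ S, (p u - ind v u + ind y u - q u) = ∑ u ∈ S, (p u - q u) := by
        simp only [sum_add_distrib, sum_sub_distrib, sum_ind, hv, hy, if_true, sub_add_cancel]
      rw [h1, h2]
      exact h.root_le
    · rw [hcut A hA]
      have h0 := h.le_cut A hA hne hAS hAX
      by_cases hA2 : 2 ≤ A.card
      · have h1 := hs A hA hA2 hAS
        split_ifs <;> omega
      · obtain ⟨a, rfl⟩ := card_eq_one.1
          (show A.card = 1 by have := hne.card_pos; omega)
        have : v ≠ a := fun hva ↦ hAX (by rw [hva])
        simp [this] at h0 ⊢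
        exact h0
  refine (ih _ _ _ _ _ ?_ key).modify fun f' hf' ↦
    ⟨fun a b ↦ ind v a * ind y b, fun a ha b hb hab ↦ ?_, fun a ha b hb hab ↦ ?_, fun u hu ↦ ?_⟩
  · simp only [sum_sub_distrib, sum_edgeInd, hv, hy]
    simp
  · have := (hf' a ha b hb hab).1
    have := ind_nonneg v a; have := ind_nonneg y b
    positivity
  · simp only [edgeInd]; ring
  · simp only [sum_sub_distrib, ← mul_sum, ← sum_mul, sum_ind, hv, hy]
    simp
    ring

/-- Lifting a pair of edges at the exempt vertex `v`. -/
lemma Admissible.orientable_of_lift_pair {v : ι} (h : Admissible m S {v} e p q β)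
    (hs : Slack m S e p q β)
    (ih : ∀ X' e' p' q' β', ∑ x ∈ S, ∑ y ∈ S, e' x y < ∑ x ∈ S, ∑ y ∈ S, e x y →
      Admissible m S X' e' p' q' β' → Orientable m S e' p' q' β')
    {y z : ι} (hv : v ∈ S) (hy : y ∈ S) (hz : z ∈ S) (hvy : v ≠ y) (hvz : v ≠ z)
    (he : 0 < e v y) (he' : 0 < e v z)
    (hyz : y = z → 2 ≤ e v y ∧
      2 * m + modNorm m (β y) ≤ cut S e (fun x ↦ p x + q x) {y}) :
    Orientable m S e p q β := by
  have hcut : ∀ A ⊆ S, cut S (fun a b ↦ e a b - edgeInd v y a b - edgeInd v z a b +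
      edgeInd y z a b) (fun x ↦ p x + q x) A =
      cut S e (fun x ↦ p x + q x) A - if v ∈ A then if y ∈ A ∨ z ∈ A then 0 else 2 else
        if y ∈ A ∧ z ∈ A then 2 else 0 := by
    intro A hA
    simp only [cut, sum_add_distrib, sum_sub_distrib, sum_edgeInd, mem_sdiff, hv, hy, hz, true_and]
    by_cases h1 : v ∈ A <;> by_cases h2 : y ∈ A <;> by_cases h3 : z ∈ A <;> simp [*] <;> ring
  have key : Admissible m S {v} (fun a b ↦ e a b - edgeInd v y a b - edgeInd v z a b +
      edgeInd y z a b) p q β := by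
    refine ⟨fun a b ↦ ?_, fun a b ↦ ?_, h.p_nonneg, h.q_nonneg, h.card_le, h.dvd_of_mem, h.two_le,
      fun A hA ↦ ?_, h.sum_dvd, h.root_le, fun A hA hne hAS hAX ↦ ?_⟩
    · rw [h.symm, edgeInd_comm v y, edgeInd_comm v z, edgeInd_comm y z]
    · have h1 := h.e_nonneg a b
      have h2 := h.symm v y
      have h3 := h.symm v z
      unfold edgeInd ind
      split_ifs <;> subst_vars <;> simp <;> first | omega | (simp_all; done) | (simp_all; omega)
    · have := h.parity A hA
      rw [hcut A hA]
      split_ifs <;> omega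
    · rw [hcut A hA]
      have h0 := h.le_cut A hA hne hAS hAX
      by_cases hA2 : 2 ≤ A.card
      · have h1 := hs A hA hA2 hAS
        split_ifs <;> omega
      · obtain ⟨a, rfl⟩ := card_eq_one.1
          (show A.card = 1 by have := hne.card_pos; omega)
        have : v ≠ a := fun hva ↦ hAX (by rw [hva])
        simp only [mem_singleton, this, if_false, sum_singleton] at h0 ⊢
        split_ifs with hc
        · obtain ⟨rfl, rfl⟩ := hc
          have := (hyz rfl).2
          omega
        · simpa using h0
  refine (ih _ _ _ _ _ ?_ key).modify fun f' hf' ↦ ?_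
  · simp only [sum_sub_distrib, sum_add_distrib, sum_edgeInd, hv, hy, hz]
    simp
  · have main : ∀ y z : ι, y ∈ S → z ∈ S → v ≠ y → v ≠ z → (y ≠ z → 1 ≤ f' y z) →
        ((∀ a ∈ S, ∀ b ∈ S, a ≠ b → 0 ≤ f' a b + (ind y a * ind v b + ind v a * ind z b -
          ind y a * ind z b)) ∧
        ∀ u ∈ S, ∑ w ∈ S, ((ind y u * ind v w + ind v u * ind z w - ind y u * ind z w) -
          (ind y w * ind v u + ind v w * ind z u - ind y w * ind z u)) = 0) := by
      intro y z hy hz hvy hvz h1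
      refine ⟨fun a ha b hb hab ↦ ?_, fun u hu ↦ ?_⟩
      · have h2 := (hf' a ha b hb hab).1
        have := mul_nonneg (ind_nonneg y a) (ind_nonneg v b)
        have := mul_nonneg (ind_nonneg v a) (ind_nonneg z b)
        by_cases hc : a = y ∧ b = z
        · obtain ⟨rfl, rfl⟩ := hc
          have := h1 hab
          have e1 : ind a a * ind b b = 1 := by simp [ind]
          linarith
        · have e1 : ind y a * ind z b = 0 := by
            simp only [ind, mul_ite, mul_one, mul_zero]
            split_ifs <;> simp_all
          linarith
      · simp only [sum_sub_distrib, sum_add_distrib, ← mul_sum, ← sum_mul, sum_ind, hv, hy, hz]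
        simp
    have hor : (y ≠ z → 1 ≤ f' y z) ∨ (z ≠ y → 1 ≤ f' z y) := by
      rcases eq_or_ne y z with heq | hne
      · left; exact fun hh ↦ absurd heq hh
      · have h1 := (hf' y hy z hz hne).2
        have h2 : edgeInd v y y z = 0 := by simp [edgeInd, ind, hvy.symm, hvz.symm]
        have h3 : edgeInd v z y z = 0 := by simp [edgeInd, ind, hvy.symm, hvz.symm]
        have h4 : edgeInd y z y z = 1 := by simp [edgeInd, ind, hne.symm]
        have h5 := h.e_nonneg y z
        have h6 : 1 ≤ f' y z + f' z y := by linarith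
        by_cases h7 : 1 ≤ f' y z
        · exact Or.inl fun _ ↦ h7
        · exact Or.inr fun _ ↦ by omega
    rcases hor with hf | hf
    · obtain ⟨m1, m2⟩ := main y z hy hz hvy hvz hf
      refine ⟨_, m1, fun a _ b _ _ ↦ ?_, fun u hu ↦ ?_⟩
      · simp only [edgeInd]; ring
      · simpa using m2 u hu
    · obtain ⟨m1, m2⟩ := main z y hz hy hvz hvy hf
      refine ⟨_, m1, fun a _ b _ _ ↦ ?_, fun u hu ↦ ?_⟩
      · simp only [edgeInd]; ring
      · simpa using m2 u hu

lemma Admissible.orientable_of_card_eq_two (hm : 0 < m) (h : Admissible m S X e p q β)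
    (hc : S.card = 2) : Orientable m S e p q β := by
  obtain ⟨x, y, hxy, rfl⟩ := card_eq_two.1 hc
  have hsx : ({x, y} : Finset ι) \ {x} = {y} := by
    ext a; simp only [mem_sdiff, mem_insert, mem_singleton]; grind
  have hsy : ({x, y} : Finset ι) \ {y} = {x} := by
    ext a; simp only [mem_sdiff, mem_insert, mem_singleton]; grind
  have hcutx : cut {x, y} e (fun x ↦ p x + q x) {x} = p x + q x + e x y := by simp [cut, hsx]
  have hcuty : cut {x, y} e (fun x ↦ p x + q x) {y} = p y + q y + e x y := by
    simp [cut, hsy, h.symm y x]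
  have hx : X ≠ {x} → 2 * m - 2 + modNorm m (β x) ≤ p x + q x + e x y := fun hX ↦ by
    have := h.le_cut {x} (by simp) (by simp) (fun heq ↦ by simp [← heq] at hc) hX.symm
    rwa [hcutx, sum_singleton] at this
  have hy : X ≠ {y} → 2 * m - 2 + modNorm m (β y) ≤ p y + q y + e x y := fun hX ↦ by
    have := h.le_cut {y} (by simp) (by simp) (fun heq ↦ by simp [← heq] at hc) hX.symm
    rwa [hcuty, sum_singleton] at this
  have hroot := h.root_le
  have hdvd := h.sum_dvd
  have hpar := h.parity {x} (by simp)
  rw [hcutx, sum_singleton] at hpar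
  simp only [sum_pair hxy] at hroot hdvd
  have hpx := h.p_nonneg x
  have hpy := h.p_nonneg y
  have hqx := h.q_nonneg x
  have hqy := h.q_nonneg y
  obtain ⟨r, hr, hnr⟩ := exists_repr m (β x + p x - q x)
  have hr2 : 2 ∣ β x + p x - q x - r := (dvd_mul_right 2 _).trans hr
  have hle : |r| ≤ e x y := by
    rw [← hnr]
    by_cases hX : X = {x}
    · have hβx := h.dvd_of_mem x (by simp [hX])
      have hY := hy (by simp [hX, hxy])
      have e1 : modNorm m (p x - q x + (p y - q y)) = modNorm m (β y) := by
        rw [← modNorm_neg hm (β y)]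
        refine modNorm_congr hm ?_
        convert Int.dvd_sub hdvd hβx using 1
        ring
      have e2 : modNorm m (β x + p x - q x) = modNorm m (p x - q x) :=
        modNorm_congr hm (by convert hβx using 1; ring)
      have e3 := modNorm_le_abs hm (p x - q x)
      have e4 : |p x - q x| ≤ p x + q x := abs_le.2 ⟨by linarith, by linarith⟩
      linarith
    by_cases hY : X = {y}
    · have hβy := h.dvd_of_mem y (by simp [hY])
      have hX := hx hX
      have e1 : modNorm m (p x - q x + (p y - q y)) = modNorm m (β x) := by
        rw [← modNorm_neg hm (β x)]
        refine modNorm_congr hm ?_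
        convert Int.dvd_sub hdvd hβy using 1
        ring
      have e2 : modNorm m (β x + p x - q x) = modNorm m (p y - q y) := by
        rw [← modNorm_neg hm (p y - q y)]
        refine modNorm_congr hm ?_
        convert Int.dvd_sub hdvd hβy using 1
        ring
      have e3 := modNorm_le_abs hm (p y - q y)
      have e4 : |p y - q y| ≤ p y + q y := abs_le.2 ⟨by linarith, by linarith⟩
      linarith
    have hX := hx hX
    have hY := hy hY
    have e1 : modNorm m (p x - q x + (p y - q y)) = modNorm m (β x + β y) := by
      rw [← modNorm_neg hm (β x + β y)]
      refine modNorm_congr hm ?_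
      convert hdvd using 1
      ring
    have e2 := modNorm_add_le hm (β x) (β y)
    have e3 := modNorm_le hm (β x + p x - q x)
    have e4 := two_dvd_modNorm_sub (m := m) (β x + p x - q x)
    omega
  have hr3 := abs_le.1 hle
  have hpos : 0 ≤ (e x y + r) / 2 := by omega
  have hneg : 0 ≤ (e x y - r) / 2 := by omega
  have hsum : (e x y + r) / 2 + (e x y - r) / 2 = e x y := by omega
  have hdiff : (e x y + r) / 2 - (e x y - r) / 2 = r := by omega
  refine ⟨fun a _ ↦ if a = x then (e x y + r) / 2 else (e x y - r) / 2, ?_, ?_⟩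
  · intro a ha b hb hab
    simp only [mem_insert, mem_singleton] at ha hb
    rcases ha with rfl | rfl <;> rcases hb with rfl | rfl
    · exact absurd rfl hab
    · simp only [if_true, hxy.symm, if_false]; exact ⟨hpos, hsum⟩
    · simp only [if_true, hxy.symm, if_false]
      exact ⟨hneg, by rw [add_comm, hsum, h.symm]⟩
    · exact absurd rfl hab
  · intro a ha
    simp only [sum_pair hxy, if_true, hxy.symm, if_false]
    simp only [mem_insert, mem_singleton] at ha
    rcases ha with rfl | rfl
    · simp only [if_true, sub_self, zero_add, hdiff]
      convert Int.dvd_neg.2 hr using 1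
      ring
    · simp only [hxy.symm, if_false, sub_self, add_zero]
      convert Int.dvd_sub hr hdvd using 1
      linarith

lemma Admissible.orientable_of_exempt (hm : 0 < m) {v : ι} (h : Admissible m S {v} e p q β)
    (hs : Slack m S e p q β) (hv : v ∈ S) (hc : 3 ≤ S.card)
    (ih : ∀ X' e' p' q' β', ∑ x ∈ S, ∑ y ∈ S, e' x y < ∑ x ∈ S, ∑ y ∈ S, e x y →
      Admissible m S X' e' p' q' β' → Orientable m S e' p' q' β') :
    Orientable m S e p q β := by
  have hβ : 2 * (m : ℤ) ∣ β v := h.dvd_of_mem v (mem_singleton_self v)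
  by_cases hno : ∀ y ∈ S, v ≠ y → e v y = 0
  · exfalso
    have hsd : S \ S.erase v = {v} := by
      ext a; simp only [mem_sdiff, mem_erase, mem_singleton]; grind
    have h1 := hs (S.erase v) (erase_subset _ _) (by rw [card_erase_of_mem hv]; omega)
      (erase_ne_self.2 hv)
    have h2 : cut S e (fun x ↦ p x + q x) (S.erase v) = ∑ x ∈ S.erase v, (p x + q x) := by
      rw [cut, add_eq_left, hsd]
      refine sum_eq_zero fun x hx ↦ ?_
      rw [sum_singleton, h.symm]
      exact hno x (mem_of_mem_erase hx) (ne_of_mem_erase hx).symm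
    have h3 := add_sum_erase S (fun x ↦ p x + q x) hv
    have h4 := h.p_nonneg v
    have h5 := h.q_nonneg v
    have h6 := h.root_le
    have h7 : modNorm m (∑ x ∈ S, (p x - q x)) = modNorm m (∑ x ∈ S.erase v, β x) := by
      rw [← modNorm_neg hm]
      refine modNorm_congr hm ?_
      have := Int.dvd_sub hβ h.sum_dvd
      convert this using 1
      have h8 := add_sum_erase S β hv
      simp only [sum_sub_distrib, sum_add_distrib, ← h8]
      ring
    omega
  push Not at hno
  obtain ⟨y, hy, hvy, hey⟩ := hno
  replace hey : 0 < e v y := lt_of_le_of_ne (h.e_nonneg v y) hey.symm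
  by_cases hp : 0 < p v
  · exact h.orientable_of_lift_arc hs ih hv hy hvy hey hp
  by_cases hq : 0 < q v
  · exact ((h.swap hm).orientable_of_lift_arc (hs.swap hm) ih hv hy hvy hey hq).of_swap h.symm
  by_cases hz : ∃ z ∈ S, v ≠ z ∧ y ≠ z ∧ 0 < e v z
  · obtain ⟨z, hz, hvz, hyz, hez⟩ := hz
    exact h.orientable_of_lift_pair hs ih hv hy hz hvy hvz hey hez fun heq ↦ absurd heq hyz
  push Not at hz
  have hz0 : ∀ z ∈ S, v ≠ z → y ≠ z → e v z = 0 := fun z hzS hvz hyz ↦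
    le_antisymm (hz z hzS hvz hyz) (h.e_nonneg v z)
  refine h.orientable_of_lift_pair hs ih hv hy hy hvy hvy hey hey fun _ ↦ ?_
  have hp0 := h.p_nonneg v
  have hq0 := h.q_nonneg v
  have hpv : p v + q v = 0 := by omega
  constructor
  · have h1 := h.parity {v} (singleton_subset_iff.2 hv)
    have h2 : cut S e (fun x ↦ p x + q x) {v} = e v y := by
      rw [cut, sum_singleton, sum_singleton, hpv, zero_add]
      refine sum_eq_single_of_mem y (by simp [hy, hvy.symm]) fun z hz hzy ↦ ?_
      rw [mem_sdiff, mem_singleton] at hz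
      exact hz0 z hz.1 (Ne.symm hz.2) hzy.symm
    have h3 : 2 ∣ β v := (dvd_mul_right 2 _).trans hβ
    rw [h2, sum_singleton] at h1
    omega
  · have h1 := hs {v, y} (by simp [insert_subset_iff, hv, hy]) (by rw [card_pair hvy])
      (fun heq ↦ by rw [← heq, card_pair hvy] at hc; omega)
    rw [sum_pair hvy] at h1
    have h2 : modNorm m (β v + β y) = modNorm m (β y) := modNorm_congr hm (by simpa using hβ)
    have h3 : S \ {y} = insert v (S \ {v, y}) := by
      ext a; simp only [mem_sdiff, mem_insert, mem_singleton]; grind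
    have h4 : ∑ z ∈ S \ {v, y}, e v z = 0 := sum_eq_zero fun z hz ↦ by
      simp only [mem_sdiff, mem_insert, mem_singleton, not_or] at hz
      exact hz0 z hz.1 (Ne.symm hz.2.1) (Ne.symm hz.2.2)
    have h5 : cut S e (fun x ↦ p x + q x) {y} = cut S e (fun x ↦ p x + q x) {v, y} + e v y := by
      rw [cut, cut, sum_pair hvy, sum_pair hvy, sum_singleton, sum_singleton, h3,
        sum_insert (by simp), h4, hpv, h.symm y v]
      ring
    omega

/-- A vertex whose prescribed value vanishes may be exempt. -/
lemma Admissible.exempt (h : Admissible m S ∅ e p q β) {v : ι} (hβ : 2 * (m : ℤ) ∣ β v) :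
    Admissible m S {v} e p q β where
  __ := h
  card_le := by simp
  dvd_of_mem x hx := by rwa [mem_singleton.1 hx]
  le_cut A hA h1 h2 _ := h.le_cut A hA h1 h2 h1.ne_empty

lemma Admissible.empty (h : Admissible m S X e p q β) (hX : ∀ v ∈ S, X ≠ {v}) :
    Admissible m S ∅ e p q β where
  __ := h
  card_le := by simp
  dvd_of_mem x hx := by simp at hx
  le_cut A hA h1 h2 _ := by
    refine h.le_cut A hA h1 h2 ?_
    rintro rfl
    obtain ⟨v, rfl⟩ := card_eq_one.1 (le_antisymm h.card_le h1.card_pos)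
    exact hX v (hA (mem_singleton_self v)) rfl

lemma Admissible.two_dvd_cut_sub_modNorm (h : Admissible m S X e p q β) {A : Finset ι}
    (hA : A ⊆ S) : 2 ∣ cut S e (fun x ↦ p x + q x) A - modNorm m (∑ x ∈ A, β x) := by
  have h1 := h.parity A hA
  have h2 := two_dvd_modNorm_sub (m := m) (∑ x ∈ A, β x)
  omega

lemma Admissible.le_cut_singleton (h : Admissible m S ∅ e p q β) {x : ι} (hx : x ∈ S) :
    2 * m - 2 + modNorm m (β x) ≤ cut S e (fun x ↦ p x + q x) {x} := by
  have := h.le_cut {x} (singleton_subset_iff.2 hx) (singleton_nonempty x)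
    (fun heq ↦ by have := h.two_le; rw [← heq, card_singleton] at this; omega)
    (singleton_nonempty x).ne_empty
  rwa [sum_singleton] at this

/-- The case where no vertex can absorb an edge. -/
lemma Admissible.orientable_of_forall_not_absorb (hm : 2 ≤ m) (h : Admissible m S ∅ e p q β)
    (hs : Slack m S e p q β) (hβ : ∀ x ∈ S, ¬ 2 * (m : ℤ) ∣ β x)
    (ih : ∀ X' e' p' q' β', ∑ x ∈ S, ∑ y ∈ S, e' x y < ∑ x ∈ S, ∑ y ∈ S, e x y →
      Admissible m S X' e' p' q' β' → Orientable m S e' p' q' β')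
    (hq : ∀ x ∈ S, q x = 0)
    (hno : ∀ x ∈ S, cut S e (fun x ↦ p x + q x) {x} < 2 * m - 1 + modNorm m (β x + 1)) :
    Orientable m S e p q β := by
  have hm0 : 0 < m := by omega
  have main : ∀ x ∈ S, cut S e (fun x ↦ p x + q x) {x} = 2 * m - 2 + modNorm m (β x) ∧
      modNorm m (β x + 1) = modNorm m (β x) + 1 ∧
      modNorm m (β x - 1) = modNorm m (β x) - 1 := by
    intro x hx
    have h1 := hno x hx
    have h2 := h.le_cut_singleton hx
    have h3 := modNorm_add_le_abs hm0 (β x) 1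
    have h4 := modNorm_sub_one_or_add_one hm0 (hβ x hx)
    have h5 := h.two_dvd_cut_sub_modNorm (singleton_subset_iff.2 hx)
    have h6 := two_dvd_modNorm_sub (m := m) (β x)
    have h7 := two_dvd_modNorm_sub (m := m) (β x + 1)
    rw [abs_one] at h3
    rw [sum_singleton] at h5
    omega
  obtain ⟨x, hx⟩ : S.Nonempty := card_pos.1 (by have := h.two_le; omega)
  obtain ⟨x', hx', y, hy, he⟩ := h.exists_edge hm (singleton_subset_iff.2 hx)
    (singleton_nonempty x)
    (fun heq ↦ by have := h.two_le; rw [← heq, card_singleton] at this; omega)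
  rw [mem_singleton] at hx'
  subst hx'
  rw [mem_sdiff, mem_singleton] at hy
  obtain ⟨hy, hyx⟩ := hy
  obtain ⟨c1, n1, -⟩ := main x' hx
  obtain ⟨c2, -, n2⟩ := main y hy
  obtain ⟨t1, t2, t3⟩ := modNorm_add_one_eq_imp hm0 (hβ x' hx) n1
  set t := modNorm m (β x')
  have hc : 0 ≤ m - t := by omega
  refine Orientable.of_add_arcs (x := x') (c := m - t)
    ((h.add_arcs hm0 hx hc ?_).orientable_of_delete_edge hm0 (hs.add_arcs hm0 hc) ih hy hx hyx
      (by rwa [h.symm]) ?_ ?_)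
  · have h1 := h.root_le
    have h2 : ∑ x ∈ S, (p x + q x) = ∑ x ∈ S, p x :=
      sum_congr rfl fun x hx ↦ by rw [hq x hx, add_zero]
    have h3 : ∑ x ∈ S, (p x - q x) = ∑ x ∈ S, p x :=
      sum_congr rfl fun x hx ↦ by rw [hq x hx, sub_zero]
    have h4 : 0 ≤ ∑ x ∈ S, p x := sum_nonneg fun x _ ↦ h.p_nonneg x
    rw [h2, h3] at h1
    rw [h2, h3]
    set s := ∑ x ∈ S, p x
    have h5 : s < 2 * m := by
      by_contra! hs
      have h6 := modNorm_le_abs_sub hm0 s 1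
      rw [abs_of_nonneg (by linarith)] at h6
      linarith
    by_cases h6 : s - (m - t) ≤ m
    · rw [modNorm_of_abs_le hm0 (abs_le.2 ⟨by linarith, h6⟩)]
      rw [abs_eq_max_neg]
      omega
    · rw [modNorm_congr hm0 (b := s - (m - t) - 2 * m) (by simp),
        modNorm_of_abs_le hm0 (abs_le.2 ⟨by linarith, by linarith⟩), abs_of_nonpos (by linarith)]
      linarith
  · have h1 : ind x' y = 0 := if_neg hyx
    rw [cut_add_arcs, if_neg fun hh ↦ hyx (mem_singleton.1 hh).symm, c2, h1, mul_zero, add_zero, n2]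
    linarith
  · have h1 : ind x' x' = 1 := if_pos rfl
    rw [cut_add_arcs, if_pos (mem_singleton_self x'), c1, h1,
      modNorm_congr hm0 (b := 1 - (m : ℤ)) (by
        convert Int.dvd_add t3 (dvd_refl (2 * (m : ℤ))) using 1
        ring)]
    have h2 := modNorm_le_abs hm0 (1 - (m : ℤ))
    rw [abs_of_nonpos (by omega)] at h2
    linarith

lemma Admissible.orientable_of_forall_not_dvd (hm : 2 ≤ m) (h : Admissible m S ∅ e p q β)
    (hs : Slack m S e p q β) (hβ : ∀ x ∈ S, ¬ 2 * (m : ℤ) ∣ β x)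
    (ih : ∀ X' e' p' q' β', ∑ x ∈ S, ∑ y ∈ S, e' x y < ∑ x ∈ S, ∑ y ∈ S, e x y →
      Admissible m S X' e' p' q' β' → Orientable m S e' p' q' β')
    (ih' : ∀ p' q' β', ∑ x ∈ S, (p' x + q' x) < ∑ x ∈ S, (p x + q x) →
      Admissible m S ∅ e p' q' β' → Orientable m S e p' q' β') :
    Orientable m S e p q β := by
  have hm0 : 0 < m := by omega
  have hsum : ∑ x ∈ S, (q x + p x) = ∑ x ∈ S, (p x + q x) := sum_congr rfl fun x _ ↦ add_comm _ _
  have hcut : ∀ x, cut S e (fun x ↦ q x + p x) {x} = cut S e (fun x ↦ p x + q x) {x} :=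
    fun x ↦ cut_congr (fun _ _ ↦ rfl) fun u ↦ add_comm _ _
  have hneg : ∀ z, modNorm m (-z - 1) = modNorm m (z + 1) := fun z ↦ by
    rw [← modNorm_neg hm0]; ring_nf
  have hneg' : ∀ z, modNorm m (-z + 1) = modNorm m (z - 1) := fun z ↦ by
    rw [← modNorm_neg hm0]; ring_nf
  let emit : ι → Prop := fun x ↦
    2 * m - 1 + modNorm m (β x - 1) ≤ cut S e (fun x ↦ p x + q x) {x}
  let absorb : ι → Prop := fun x ↦
    2 * m - 1 + modNorm m (β x + 1) ≤ cut S e (fun x ↦ p x + q x) {x}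
  have hor : ∀ x ∈ S, emit x ∨ absorb x := by
    intro x hx
    have h2 := h.le_cut_singleton hx
    have h4 := modNorm_sub_one_or_add_one hm0 (hβ x hx)
    simp only [emit, absorb]
    omega
  by_cases h1 : ∃ x ∈ S, ∃ y ∈ S, x ≠ y ∧ 0 < e x y ∧ emit x ∧ absorb y
  · obtain ⟨x, hx, y, hy, hxy, he, hex, hay⟩ := h1
    exact h.orientable_of_delete_edge hm0 hs ih hx hy hxy he hex hay
  by_cases h2 : ∃ x ∈ S, 0 < q x ∧ emit x
  · obtain ⟨x, hx, hq, hex⟩ := h2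
    exact h.orientable_of_delete_arc hm0 hs ih' hx hq hex
  by_cases h3 : ∃ x ∈ S, 0 < p x ∧ absorb x
  · obtain ⟨x, hx, hp, hax⟩ := h3
    refine ((h.swap hm0).orientable_of_delete_arc hm0 (hs.swap hm0) ?_ hx hp ?_).of_swap h.symm
    · simpa only [hsum] using ih'
    · rw [hcut, hneg]; exact hax
  push Not at h1 h2 h3
  by_cases h4 : ∀ x ∈ S, ¬ absorb x
  · refine h.orientable_of_forall_not_absorb hm hs hβ ih (fun x hx ↦ ?_)
      fun x hx ↦ not_le.1 (h4 x hx)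
    have h5 := h.q_nonneg x
    have h6 := mt (h2 x hx) (not_not.2 ((hor x hx).resolve_right (h4 x hx)))
    omega
  by_cases h4' : ∀ x ∈ S, ¬ emit x
  · refine ((h.swap hm0).orientable_of_forall_not_absorb hm (hs.swap hm0)
      (fun x hx ↦ by simpa using hβ x hx) ih (fun x hx ↦ ?_) fun x hx ↦ ?_).of_swap h.symm
    · have h5 := h.p_nonneg x
      have h6 := mt (h3 x hx) (not_not.2 ((hor x hx).resolve_left (h4' x hx)))
      omega
    · rw [hcut, hneg']; exact not_le.1 (h4' x hx)
  push Not at h4 h4'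
  exfalso
  obtain ⟨x, hx, hax⟩ := h4
  obtain ⟨y, hy, hey⟩ := h4'
  classical
  by_cases hP : ∃ z ∈ S, ¬ absorb z
  · obtain ⟨z, hz, haz⟩ := hP
    obtain ⟨u, hu, w, hw, he⟩ := h.exists_edge hm (filter_subset (fun z ↦ ¬ absorb z) S)
      ⟨z, mem_filter.2 ⟨hz, haz⟩⟩ (fun heq ↦ by rw [← heq] at hx; exact (mem_filter.1 hx).2 hax)
    rw [mem_sdiff, mem_filter, not_and, not_not] at hw
    rw [mem_filter] at hu
    exact h1 u hu.1 w hw.1 (fun heq ↦ hu.2 (heq ▸ hw.2 hw.1)) he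
      ((hor u hu.1).resolve_right hu.2) (hw.2 hw.1)
  · push Not at hP
    obtain ⟨u, hu, w, hw, he⟩ := h.exists_edge hm (singleton_subset_iff.2 hy)
      (singleton_nonempty y)
      (fun heq ↦ by have := h.two_le; rw [← heq, card_singleton] at this; omega)
    rw [mem_singleton] at hu
    subst hu
    rw [mem_sdiff, mem_singleton] at hw
    exact h1 u hy w hw.1 (Ne.symm hw.2) he hey (hP w hw.1)

/-- Identifying vertices along `π` preserves the degree conditions. -/
lemma Admissible.quotient (h : Admissible m S X e p q β) {π : ι → ι} {S' : Finset ι}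
    (hπ : ∀ x ∈ S, π x ∈ S') (hsurj : ∀ u ∈ S', ∃ x ∈ S, π x = u) (hc : 2 ≤ S'.card) :
    Admissible m S' {u ∈ S' | {x ∈ S | π x = u} = X}
      (fun u v ↦ ∑ x ∈ S with π x = u, ∑ y ∈ S with π y = v, e x y)
      (fun u ↦ ∑ x ∈ S with π x = u, p x) (fun u ↦ ∑ x ∈ S with π x = u, q x)
      (fun u ↦ ∑ x ∈ S with π x = u, β x) := by
  have hall : {x ∈ S | π x ∈ S'} = S := filter_true_of_mem hπ
  have hcut : ∀ B ⊆ S', cut S' (fun u v ↦ ∑ x ∈ S with π x = u, ∑ y ∈ S with π y = v, e x y)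
      (fun u ↦ ∑ x ∈ S with π x = u, p x + ∑ x ∈ S with π x = u, q x) B =
      cut S e (fun x ↦ p x + q x) {x ∈ S | π x ∈ B} := by
    intro B hB
    have h1 : S \ {x ∈ S | π x ∈ B} = {x ∈ S | π x ∈ S' \ B} := by
      ext x
      simp only [mem_sdiff, mem_filter]
      have := hπ x
      tauto
    simp only [cut, h1, ← sum_add_distrib]
    have h2 : ∀ u, ∑ v ∈ S' \ B, ∑ x ∈ S with π x = u, ∑ y ∈ S with π y = v, e x y =
        ∑ x ∈ S with π x = u, ∑ y ∈ S with π y ∈ S' \ B, e x y := by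
      intro u
      rw [sum_comm]
      exact sum_congr rfl fun x _ ↦ sum_fiberwise_eq_sum_filter _ _ _ _
    simp only [h2, ← sum_add_distrib]
    exact sum_fiberwise_eq_sum_filter _ _ _ _
  have hone : ({u ∈ S' | {x ∈ S | π x = u} = X} : Finset ι).card ≤ 1 := by
    refine card_le_one.2 fun u hu v hv ↦ ?_
    rw [mem_filter] at hu hv
    obtain ⟨x, hx, rfl⟩ := hsurj u hu.1
    have h1 : x ∈ {y ∈ S | π y = π x} := by simp [hx]
    rw [hu.2, ← hv.2] at h1
    exact (mem_filter.1 h1).2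
  refine ⟨fun u v ↦ ?_, fun u v ↦ ?_, fun u ↦ ?_, fun u ↦ ?_, hone, fun u hu ↦ ?_, hc,
    fun B hB ↦ ?_, ?_, ?_, fun B hB hne hBS hBX ↦ ?_⟩
  · rw [sum_comm]
    exact sum_congr rfl fun x _ ↦ sum_congr rfl fun y _ ↦ h.symm _ _
  · exact sum_nonneg fun x _ ↦ sum_nonneg fun y _ ↦ h.e_nonneg x y
  · exact sum_nonneg fun x _ ↦ h.p_nonneg x
  · exact sum_nonneg fun x _ ↦ h.q_nonneg x
  · rw [(mem_filter.1 hu).2]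
    exact dvd_sum fun x hx ↦ h.dvd_of_mem x hx
  · rw [hcut B hB, sum_fiberwise_eq_sum_filter]
    exact h.parity _ (filter_subset _ _)
  · simp only [← sum_add_distrib, ← sum_sub_distrib]
    rw [sum_fiberwise_eq_sum_filter, hall]
    exact h.sum_dvd
  · simp only [← sum_add_distrib, ← sum_sub_distrib]
    rw [sum_fiberwise_eq_sum_filter, sum_fiberwise_eq_sum_filter, hall]
    exact h.root_le
  · rw [hcut B hB, sum_fiberwise_eq_sum_filter]
    refine h.le_cut _ (filter_subset _ _) ?_ (fun heq ↦ ?_) (fun heq ↦ ?_)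
    · obtain ⟨u, hu⟩ := hne
      obtain ⟨x, hx, rfl⟩ := hsurj u (hB hu)
      exact ⟨x, mem_filter.2 ⟨hx, hu⟩⟩
    · refine hBS (hB.antisymm fun u hu ↦ ?_)
      obtain ⟨x, hx, rfl⟩ := hsurj u hu
      rw [← heq] at hx
      exact (mem_filter.1 hx).2
    · have hsub : ∀ u ∈ B, {x ∈ S | π x = u} = X := by
        intro u hu
        have h1 : {x ∈ S | π x = u} ⊆ X := by
          rw [← heq]
          exact monotone_filter_right _ fun x _ hx ↦ by rw [hx]; exact hu
        refine eq_of_subset_of_card_le h1 (h.card_le.trans (card_pos.2 ?_))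
        obtain ⟨x, hx, rfl⟩ := hsurj u (hB hu)
        exact ⟨x, mem_filter.2 ⟨hx, rfl⟩⟩
      refine hBX (eq_of_subset_of_card_le (fun u hu ↦ mem_filter.2 ⟨hB hu, hsub u hu⟩)
        (hone.trans hne.card_pos))

/-- Orienting the contraction of `A` first, and then the edges inside `A`. -/
lemma Admissible.orientable_of_contract (hm : 0 < m) (h : Admissible m S X e p q β)
    (ih : ∀ (S' X' : Finset ι) e' p' q' β', S'.card < S.card → Admissible m S' X' e' p' q' β' →
      Orientable m S' e' p' q' β')
    {A : Finset ι} (hA : A ⊆ S) (hA2 : 2 ≤ A.card) (hAS : A ≠ S)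
    (hcut : cut S e (fun x ↦ p x + q x) A ≤ 2 * m - 2 + modNorm m (∑ x ∈ A, β x)) :
    Orientable m S e p q β := by
  obtain ⟨a, ha⟩ : A.Nonempty := card_pos.1 (by omega)
  have haS : a ∉ S \ A := by simp [ha]
  have hcard := card_sdiff_add_card_eq_card hA
  have hlt := card_lt_card (hA.ssubset_of_ne hAS)
  have hfa : {x ∈ S | (if x ∈ A then a else x : ι) = a} = A := by
    ext x
    have := @hA x
    simp only [mem_filter, ite_eq_left_iff]
    grind
  have hfv : ∀ v ∈ S \ A, {x ∈ S | (if x ∈ A then a else x : ι) = v} = {v} := by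
    intro v hv
    rw [mem_sdiff] at hv
    ext x
    simp only [mem_filter, mem_singleton]
    grind
  have h1 := h.quotient (π := fun x : ι ↦ if x ∈ A then a else x) (S' := insert a (S \ A))
    (fun x hx ↦ by simp only [mem_insert, mem_sdiff]; grind)
    (fun u hu ↦ by
      rcases mem_insert.1 hu with rfl | hu
      · exact ⟨u, hA ha, by simp⟩
      · rw [mem_sdiff] at hu
        exact ⟨u, hu.1, by simp [hu.2]⟩)
    (by rw [card_insert_of_notMem haS]; omega)
  obtain ⟨f, hf, hfβ⟩ := ih _ _ _ _ _ _ (by rw [card_insert_of_notMem haS]; omega) h1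
  simp only [sum_insert haS] at hfβ
  have hav : ∀ v ∈ S \ A, 0 ≤ f a v ∧ f a v + f v a = ∑ x ∈ A, e x v := by
    intro v hv
    have := hf a (mem_insert_self _ _) v (mem_insert_of_mem hv) (ne_of_mem_of_not_mem hv haS).symm
    simpa only [hfa, hfv v hv, sum_singleton] using this
  have hva : ∀ v ∈ S \ A, 0 ≤ f v a := fun v hv ↦
    (hf v (mem_insert_of_mem hv) a (mem_insert_self _ _) (ne_of_mem_of_not_mem hv haS)).1
  have hvw : ∀ v ∈ S \ A, ∀ w ∈ S \ A, v ≠ w → 0 ≤ f v w ∧ f v w + f w v = e v w := by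
    intro v hv w hw hvw
    have := hf v (mem_insert_of_mem hv) w (mem_insert_of_mem hw) hvw
    simpa only [hfv v hv, hfv w hw, sum_singleton] using this
  have hβa := hfβ a (mem_insert_self _ _)
  have hβv : ∀ v ∈ S \ A, 2 * (m : ℤ) ∣
      f v a - f a v + ∑ w ∈ S \ A, (f v w - f w v) + q v - p v - β v := by
    intro v hv
    have := hfβ v (mem_insert_of_mem hv)
    simpa only [hfv v hv, sum_singleton] using this
  simp only [hfa] at hβa
  have hsplit : ∀ v, ∃ g : ι → ℤ, v ∈ S \ A →
      (∀ x, 0 ≤ g x ∧ g x ≤ e x v) ∧ ∑ x ∈ A, g x = f a v := by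
    intro v
    by_cases hv : v ∈ S \ A
    · obtain ⟨g, hg⟩ := exists_sum_eq_of_le (A := A) (c := fun x ↦ e x v) (t := f a v)
        (fun x ↦ h.e_nonneg x v) (hav v hv).1 (by
          have := (hav v hv).2
          have := hva v hv
          linarith)
      exact ⟨g, fun _ ↦ hg⟩
    · exact ⟨fun _ ↦ 0, fun hv' ↦ absurd hv' hv⟩
  choose g hg using hsplit
  have hS : ∀ F : ι → ℤ, ∑ y ∈ S, F y = ∑ y ∈ A, F y + ∑ y ∈ S \ A, F y := fun F ↦ by
    rw [add_comm, sum_sdiff hA]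
  have hcut2 : ∀ B ⊆ A, cut A e (fun x ↦ p x + ∑ v ∈ S \ A, (e x v - g v x) +
      (q x + ∑ v ∈ S \ A, g v x)) B = cut S e (fun x ↦ p x + q x) B := by
    intro B hB
    have e1 : ∀ x, ∑ y ∈ S \ B, e x y = ∑ y ∈ S \ A, e x y + ∑ y ∈ A \ B, e x y := by
      intro x
      rw [← sum_union (by
        rw [disjoint_left]; intro y hy hy'; exact (mem_sdiff.1 hy).2 (mem_sdiff.1 hy').1)]
      refine sum_congr ?_ fun _ _ ↦ rfl
      ext y
      have := @hA y
      have := @hB y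
      simp only [mem_sdiff, mem_union]
      tauto
    simp only [cut, e1, ← sum_add_distrib]
    refine sum_congr rfl fun x _ ↦ ?_
    rw [sum_sub_distrib]
    ring
  have hdvd2 : 2 * (m : ℤ) ∣ ∑ x ∈ A, (β x + (p x + ∑ v ∈ S \ A, (e x v - g v x)) -
      (q x + ∑ v ∈ S \ A, g v x)) := by
    convert Int.dvd_neg.2 hβa using 1
    have e1 : ∑ x ∈ A, ∑ v ∈ S \ A, g v x = ∑ v ∈ S \ A, f a v := by
      rw [sum_comm]
      exact sum_congr rfl fun v hv ↦ (hg v hv).2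
    have e2 : ∑ x ∈ A, ∑ v ∈ S \ A, e x v = ∑ v ∈ S \ A, (f a v + f v a) := by
      rw [sum_comm]
      exact sum_congr rfl fun v hv ↦ (hav v hv).2.symm
    simp only [sum_add_distrib, sum_sub_distrib, e1, e2]
    ring
  have h2 : Admissible m A X e (fun x ↦ p x + ∑ v ∈ S \ A, (e x v - g v x))
      (fun x ↦ q x + ∑ v ∈ S \ A, g v x) β := by
    refine ⟨h.symm, h.e_nonneg, fun x ↦ ?_, fun x ↦ ?_, h.card_le, h.dvd_of_mem, hA2,
      fun B hB ↦ ?_, hdvd2, ?_, fun B hB hne hBA hBX ↦ ?_⟩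
    · exact add_nonneg (h.p_nonneg x) (sum_nonneg fun v hv ↦ sub_nonneg.2 ((hg v hv).1 x).2)
    · exact add_nonneg (h.q_nonneg x) (sum_nonneg fun v hv ↦ ((hg v hv).1 x).1)
    · rw [hcut2 B hB]
      exact h.parity B (hB.trans hA)
    · have e1 := hcut2 A subset_rfl
      rw [cut, Finset.sdiff_self] at e1
      simp only [sum_empty, sum_const_zero, add_zero] at e1
      rw [e1]
      refine hcut.trans_eq ?_
      rw [← modNorm_neg hm, modNorm_congr hm]
      convert Int.dvd_neg.2 hdvd2 using 1
      simp only [sum_add_distrib, sum_sub_distrib]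
      ring
    · rw [hcut2 B hB]
      exact h.le_cut B (hB.trans hA) hne
        (fun heq ↦ hAS (hA.antisymm (heq ▸ hB))) hBX
  obtain ⟨f', hf', hf'β⟩ := ih _ _ _ _ _ _ hlt h2
  refine ⟨fun x y ↦ if x ∈ A then (if y ∈ A then f' x y else g y x) else
    (if y ∈ A then e x y - g x y else f x y), fun x hx y hy hxy ↦ ?_, fun x hx ↦ ?_⟩
  · by_cases hxA : x ∈ A <;> by_cases hyA : y ∈ A <;> simp only [hxA, hyA, if_true, if_false]
    · exact hf' x hxA y hyA hxy
    · refine ⟨((hg y (mem_sdiff.2 ⟨hy, hyA⟩)).1 x).1, ?_⟩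
      rw [h.symm y x]; ring
    · refine ⟨sub_nonneg.2 ?_, by ring⟩
      rw [h.symm]
      exact ((hg x (mem_sdiff.2 ⟨hx, hxA⟩)).1 y).2
    · exact hvw x (mem_sdiff.2 ⟨hx, hxA⟩) y (mem_sdiff.2 ⟨hy, hyA⟩) hxy
  · rw [hS]
    have hnA : ∀ y ∈ S \ A, y ∉ A := fun y hy ↦ (mem_sdiff.1 hy).2
    by_cases hxA : x ∈ A
    · convert hf'β x hxA using 1
      have e1 : ∀ F F' : ι → ℤ, ∑ y ∈ A, ((if y ∈ A then f' x y else F y) -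
          if y ∈ A then f' y x else F' y) = ∑ y ∈ A, (f' x y - f' y x) := fun F F' ↦
        sum_congr rfl fun y hy ↦ by rw [if_pos hy, if_pos hy]
      have e2 : ∀ F F' : ι → ℤ, ∑ y ∈ S \ A, ((if y ∈ A then F y else g y x) -
          if y ∈ A then F' y else e y x - g y x) =
          ∑ y ∈ S \ A, g y x - ∑ y ∈ S \ A, (e x y - g y x) := fun F F' ↦ by
        rw [← sum_sub_distrib]
        exact sum_congr rfl fun y hy ↦ by rw [if_neg (hnA y hy), if_neg (hnA y hy), h.symm]
      simp only [hxA, if_true, e1, e2]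
      ring
    · have hxSA := mem_sdiff.2 ⟨hx, hxA⟩
      convert hβv x hxSA using 1
      have e1 : ∀ F F' : ι → ℤ, ∑ y ∈ A, ((if y ∈ A then e x y - g x y else F y) -
          if y ∈ A then g x y else F' y) = f x a - f a x := fun F F' ↦ by
        have e3 : ∑ y ∈ A, (e x y - g x y - g x y) = f x a - f a x := by
          have e4 := (hg x hxSA).2
          have e5 := (hav x hxSA).2
          simp only [h.symm x, sum_sub_distrib, e4, ← e5]
          ring
        rw [← e3]
        exact sum_congr rfl fun y hy ↦ by rw [if_pos hy, if_pos hy]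
      have e2 : ∀ F F' : ι → ℤ, ∑ y ∈ S \ A, ((if y ∈ A then F y else f x y) -
          if y ∈ A then F' y else f y x) = ∑ y ∈ S \ A, (f x y - f y x) := fun F F' ↦
        sum_congr rfl fun y hy ↦ by rw [if_neg (hnA y hy), if_neg (hnA y hy)]
      simp only [hxA, if_false, e1, e2]

/-- The degree conditions ensure that the orientation at the root extends. -/
theorem Admissible.orientable (hm : 2 ≤ m) (h : Admissible m S X e p q β) :
    Orientable m S e p q β := by
  have hm0 : 0 < m := by omega
  obtain ⟨n, hn⟩ : ∃ n, n = S.card := ⟨_, rfl⟩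
  induction n using Nat.strong_induction_on generalizing S X e p q β with
  | _ n ihn =>
  obtain ⟨n₁, hn₁⟩ : ∃ n₁, n₁ = (∑ x ∈ S, ∑ y ∈ S, e x y).toNat := ⟨_, rfl⟩
  induction n₁ using Nat.strong_induction_on generalizing X e p q β with
  | _ n₁ ihe =>
  obtain ⟨n₂, hn₂⟩ : ∃ n₂, n₂ = (∑ x ∈ S, (p x + q x)).toNat := ⟨_, rfl⟩
  induction n₂ using Nat.strong_induction_on generalizing X p q β with
  | _ n₂ ihp =>
  by_cases hc : S.card = 2
  · exact h.orientable_of_card_eq_two hm0 hc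
  have hc3 : 3 ≤ S.card := by have := h.two_le; omega
  by_cases hs : Slack m S e p q β
  · have ih : ∀ X' e' p' q' β', ∑ x ∈ S, ∑ y ∈ S, e' x y < ∑ x ∈ S, ∑ y ∈ S, e x y →
        Admissible m S X' e' p' q' β' → Orientable m S e' p' q' β' := by
      intro X' e' p' q' β' hlt h'
      have h0 : 0 ≤ ∑ x ∈ S, ∑ y ∈ S, e' x y :=
        sum_nonneg fun x _ ↦ sum_nonneg fun y _ ↦ h'.e_nonneg x y
      exact ihe _ (by omega) h' rfl
    by_cases hX : ∃ v ∈ S, X = {v}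
    · obtain ⟨v, hv, rfl⟩ := hX
      exact h.orientable_of_exempt hm0 hs hv hc3 ih
    push Not at hX
    replace h := h.empty hX
    by_cases hβ : ∃ v ∈ S, 2 * (m : ℤ) ∣ β v
    · obtain ⟨v, hv, hβ⟩ := hβ
      exact (h.exempt hβ).orientable_of_exempt hm0 hs hv hc3 ih
    push Not at hβ
    refine h.orientable_of_forall_not_dvd hm hs hβ ih fun p' q' β' hlt h' ↦ ?_
    have h0 : 0 ≤ ∑ x ∈ S, (p' x + q' x) :=
      sum_nonneg fun x _ ↦ add_nonneg (h'.p_nonneg x) (h'.q_nonneg x)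
    exact ihp _ (by omega) h' rfl
  · unfold Slack at hs
    push Not at hs
    obtain ⟨A, hA, hA2, hAS, hlt⟩ := hs
    refine h.orientable_of_contract hm0 (fun S' X' e' p' q' β' hlt' h' ↦ ?_) hA hA2 hAS ?_
    · exact ihn _ (by omega) h' rfl
    · have := h.two_dvd_cut_sub_modNorm hA
      omega

end Orientation

section MaxCut

open Finset

variable {V : Type*}

open Classical in
/-- The indicator function of the edges `xy` of `G` with exactly one end in `T`. -/
noncomputable def crossInd (G : SimpleGraph V) (T : Finset V) (x y : V) : ℤ :=
  if G.Adj x y ∧ (x ∈ T ↔ y ∉ T) then 1 else 0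

open Classical in
/-- The indicator function of the edges `xy` of `G` with `x ∈ T` and `y ∉ T`. -/
noncomputable def outInd (G : SimpleGraph V) (T : Finset V) (x y : V) : ℤ :=
  if G.Adj x y ∧ x ∈ T ∧ y ∉ T then 1 else 0

variable {G : SimpleGraph V} {T : Finset V}

lemma crossInd_eq (x y : V) : crossInd G T x y = outInd G T x y + outInd G T y x := by
  unfold crossInd outInd
  rw [G.adj_comm y x]
  split_ifs <;> simp <;> tauto

lemma crossInd_comm (x y : V) : crossInd G T x y = crossInd G T y x := by
  rw [crossInd_eq, crossInd_eq, add_comm]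

lemma crossInd_nonneg (x y : V) : 0 ≤ crossInd G T x y := by
  unfold crossInd; split_ifs <;> simp

lemma two_dvd_sum_crossInd (A : Finset V) : 2 ∣ ∑ x ∈ A, ∑ y ∈ A, crossInd G T x y := by
  refine ⟨∑ x ∈ A, ∑ y ∈ A, outInd G T x y, ?_⟩
  simp only [crossInd_eq, sum_add_distrib]
  rw [sum_comm (f := fun x y ↦ outInd G T y x), two_mul]

variable [Fintype V]

/-- Edge connectivity bounds the number of edges leaving a vertex set. -/
lemma IsMEdgeConnected.le_card_edges [DecidableEq V] [DecidableRel G.Adj] {n : ℕ}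
    (h : IsMEdgeConnected G n) {A : Finset V} (hne : A.Nonempty) (hA : A ≠ univ) :
    n ≤ #{z ∈ A ×ˢ (univ \ A) | G.Adj z.1 z.2} := by
  by_contra! hlt
  set E := {z ∈ A ×ˢ (univ \ A) | G.Adj z.1 z.2}
  have hcon := h (E.image fun z ↦ s(z.1, z.2)) (by
    have := card_image_le (s := E) (f := fun z ↦ s(z.1, z.2))
    omega)
  obtain ⟨x, hx⟩ := hne
  obtain ⟨y, hy⟩ : ∃ y, y ∉ A := by
    by_contra! hall
    exact hA (eq_univ_iff_forall.2 hall)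
  obtain ⟨w⟩ := hcon.preconnected x y
  obtain ⟨d, -, hd1, hd2⟩ := w.exists_boundary_dart (A : Set V) hx hy
  have hadj := d.adj
  rw [SimpleGraph.deleteEdges_adj] at hadj
  refine hadj.2 ?_
  refine mem_image.2 ⟨(d.fst, d.snd), ?_, rfl⟩
  exact mem_filter.2 ⟨mem_product.2 ⟨hd1, mem_sdiff.2 ⟨mem_univ _, hd2⟩⟩, hadj.1⟩

/-- In a maximum cut, at least half of the edges leaving a vertex set cross. -/
lemma sum_adj_le_two_mul_sum_crossInd [DecidableEq V] [DecidableRel G.Adj]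
    (hT : ∀ T' : Finset V, ∑ x, ∑ y, crossInd G T' x y ≤ ∑ x, ∑ y, crossInd G T x y)
    (A : Finset V) :
    ∑ x ∈ A, ∑ y ∈ univ \ A, (if G.Adj x y then 1 else 0 : ℤ) ≤
      2 * ∑ x ∈ A, ∑ y ∈ univ \ A, crossInd G T x y := by
  have h1 := hT (symmDiff T A)
  let d : V → V → ℤ := fun x y ↦ (if G.Adj x y then 1 else 0) - 2 * crossInd G T x y
  let l : V → V → ℤ := fun x y ↦ if x ∈ A then if y ∈ univ \ A then d x y else 0 else 0
  have h2 : ∀ x y, crossInd G (symmDiff T A) x y = crossInd G T x y + l x y + l y x := by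
    intro x y
    simp only [l, d, crossInd_comm y x, G.adj_comm y x]
    simp only [crossInd, mem_symmDiff, mem_sdiff, mem_univ, true_and]
    by_cases h1 : G.Adj x y <;> by_cases h2 : x ∈ T <;> by_cases h3 : y ∈ T <;>
      by_cases h4 : x ∈ A <;> by_cases h5 : y ∈ A <;> simp [*]
  have h3 : ∑ x, ∑ y, l x y = ∑ x ∈ A, ∑ y ∈ univ \ A, d x y := by
    simp only [l]
    rw [← sum_filter_add_sum_filter_not univ (· ∈ A)]
    simp only [filter_mem_eq_inter, univ_inter]
    rw [sum_congr rfl fun x hx ↦ sum_congr rfl fun y _ ↦ if_pos hx,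
      sum_eq_zero (s := {x ∈ univ | x ∉ A}) fun x hx ↦ sum_eq_zero fun y _ ↦
        if_neg (mem_filter.1 hx).2, add_zero]
    exact sum_congr rfl fun x _ ↦ by rw [sum_ite_mem, univ_inter]
  simp only [h2, sum_add_distrib] at h1
  rw [sum_comm (f := fun x y ↦ l y x), h3] at h1
  simp only [d, sum_sub_distrib, ← mul_sum] at h1
  linarith

variable (G T) in
/-- The prescribed values for the orientation of the crossing edges. -/
noncomputable def cutDemand (k : ℕ) (x : V) : ℤ :=
  open Classical in
  if x ∈ T then 2 * k - ∑ y, crossInd G T x y else ∑ y, crossInd G T x y - 2 * k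

lemma two_dvd_sum_cutDemand (k : ℕ) (A : Finset V) :
    2 ∣ ∑ x ∈ A, ∑ y, crossInd G T x y - ∑ x ∈ A, cutDemand G T k x := by
  rw [← sum_sub_distrib]
  refine dvd_sum fun x _ ↦ ?_
  unfold cutDemand
  split_ifs <;> omega

lemma dvd_sum_cutDemand (heven : Even (Fintype.card V)) (k : ℕ) :
    2 * ((2 * k : ℕ) : ℤ) ∣ ∑ x, cutDemand G T k x := by
  classical
  have h1 : ∀ x, cutDemand G T k x = (if x ∈ T then 2 * (2 * k : ℤ) else 0) - 2 * k -
      (∑ y, outInd G T x y - ∑ y, outInd G T y x) := by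
    intro x
    simp only [cutDemand, crossInd_eq, sum_add_distrib]
    split_ifs with hx
    · have : ∑ y, outInd G T y x = 0 := sum_eq_zero fun y _ ↦ if_neg fun hh ↦ hh.2.2 hx
      rw [this]; ring
    · have : ∑ y, outInd G T x y = 0 := sum_eq_zero fun y _ ↦ if_neg fun hh ↦ hx hh.2.1
      rw [this]; ring
  obtain ⟨c, hc⟩ := heven
  simp only [h1, sum_sub_distrib]
  rw [sum_comm (f := fun x y ↦ outInd G T y x), sub_self, sub_zero, sum_ite_mem, univ_inter,
    sum_const, sum_const, card_univ, hc]
  refine ⟨#T - c, ?_⟩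
  push_cast [nsmul_eq_mul]
  ring

lemma admissible_crossInd [DecidableEq V] {k : ℕ} (hk : 1 ≤ k)
    (hconn : IsMEdgeConnected G (12 * k - 7)) (heven : Even (Fintype.card V))
    (hT : ∀ T' : Finset V, ∑ x, ∑ y, crossInd G T' x y ≤ ∑ x, ∑ y, crossInd G T x y) :
    Admissible (2 * k) univ ∅ (crossInd G T) 0 0 (cutDemand G T k) := by
  classical
  have hpar : ∀ A : Finset V, 2 ∣ cut univ (crossInd G T)
      (fun x ↦ (0 : V → ℤ) x + (0 : V → ℤ) x) A - ∑ x ∈ A, cutDemand G T k x := by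
    intro A
    have h1 := two_dvd_sum_cutDemand (G := G) (T := T) k A
    have h2 := two_dvd_sum_crossInd (G := G) (T := T) A
    have h3 : ∑ x ∈ A, ∑ y, crossInd G T x y = ∑ x ∈ A, ∑ y ∈ A, crossInd G T x y +
        ∑ x ∈ A, ∑ y ∈ univ \ A, crossInd G T x y := by
      rw [← sum_add_distrib]
      exact sum_congr rfl fun x _ ↦ by rw [add_comm, sum_sdiff (subset_univ A)]
    simp only [cut, Pi.zero_apply, add_zero, sum_const_zero, zero_add]
    omega
  refine ⟨crossInd_comm, crossInd_nonneg, fun _ ↦ le_rfl, fun _ ↦ le_rfl, by simp, by simp, ?_,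
    fun A _ ↦ hpar A, ?_, ?_, fun A _ hne hA _ ↦ ?_⟩
  · obtain ⟨v⟩ := (hconn ∅ (by simp)).nonempty
    have : 0 < Fintype.card V := Fintype.card_pos_iff.2 ⟨v⟩
    rw [card_univ]
    obtain ⟨c, hc⟩ := heven
    omega
  · simpa using dvd_sum_cutDemand heven k
  · have := modNorm_nonneg (m := 2 * k) 0
    simp only [Pi.zero_apply, add_zero, sub_zero, sum_const_zero]
    push_cast
    omega
  · have h1 := hpar A
    have h2 := two_dvd_modNorm_sub (m := 2 * k) (∑ x ∈ A, cutDemand G T k x)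
    have h3 := modNorm_le (m := 2 * k) (by omega) (∑ x ∈ A, cutDemand G T k x)
    have h4 := sum_adj_le_two_mul_sum_crossInd hT A
    have h5 := hconn.le_card_edges hne hA
    have h6 : (#{z ∈ A ×ˢ (univ \ A) | G.Adj z.1 z.2} : ℤ) =
        ∑ x ∈ A, ∑ y ∈ univ \ A, (if G.Adj x y then 1 else 0 : ℤ) := by
      rw [natCast_card_filter, sum_product]
    simp only [cut, Pi.zero_apply, add_zero, sum_const_zero, zero_add] at h1 ⊢
    push_cast at h3 ⊢
    omega

/-- An orientation of the crossing edges yields the desired spanning subgraph. -/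
lemma exists_subgraph_of_orientable {k : ℕ} (hk : 1 ≤ k)
    (h : Orientable (2 * k) univ (crossInd G T) 0 0 (cutDemand G T k)) :
    ∃ H : SimpleGraph V, H ≤ G ∧ ∀ v : V, Nat.card (H.neighborSet v) % (2 * k) = k := by
  classical
  obtain ⟨f, hf, hfβ⟩ := h
  have hle : ∀ x y, crossInd G T x y ≤ 1 := fun x y ↦ by unfold crossInd; split_ifs <;> simp
  let H : SimpleGraph V :=
    { Adj := fun x y ↦ x ∈ T ∧ y ∉ T ∧ f x y = 1 ∨ y ∈ T ∧ x ∉ T ∧ f y x = 1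
      symm := ⟨fun x y hxy ↦ hxy.symm⟩
      loopless := ⟨fun x hx ↦ by tauto⟩ }
  have hadj : ∀ x y, x ≠ y → f x y = 1 → G.Adj x y := by
    intro x y hxy h1
    have h2 := (hf x (mem_univ x) y (mem_univ y) hxy).2
    have h3 := (hf y (mem_univ y) x (mem_univ x) hxy.symm).1
    by_contra hno
    have h4 : crossInd G T x y = 0 := if_neg fun hh ↦ hno hh.1
    omega
  refine ⟨H, fun x y hxy ↦ ?_, fun v ↦ ?_⟩
  · have hne := hxy.ne
    rcases hxy with hxy | hxy
    · exact hadj x y hne hxy.2.2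
    · exact (hadj y x hne.symm hxy.2.2).symm
  have hcard : (Nat.card (H.neighborSet v) : ℤ) = ∑ y, if H.Adj v y then 1 else 0 := by
    rw [Nat.card_eq_fintype_card, SimpleGraph.card_neighborSet_eq_degree,
      ← SimpleGraph.card_neighborFinset_eq_degree, SimpleGraph.neighborFinset_eq_filter,
      natCast_card_filter]
  have hsame : ∀ x y, (x ∈ T ↔ y ∈ T) → crossInd G T x y = 0 := fun x y hxy ↦
    if_neg fun hh ↦ by tauto
  have hdiff : ∀ y, f v y - f y v = if v ∈ T then
      2 * (if H.Adj v y then 1 else 0) - crossInd G T v y else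
      crossInd G T v y - 2 * (if H.Adj v y then 1 else 0) := by
    intro y
    rcases eq_or_ne v y with rfl | hvy
    · simp [hsame v v Iff.rfl]
    have h1 := hf v (mem_univ v) y (mem_univ y) hvy
    have h2 := (hf y (mem_univ y) v (mem_univ v) hvy.symm).1
    have h3 := hle v y
    by_cases hv : v ∈ T <;> by_cases hy : y ∈ T
    · have h4 := hsame v y (by tauto)
      have h5 : ¬ H.Adj v y := by simp [H, hv, hy]
      rw [if_pos hv, if_neg h5]; omega
    · have h5 : H.Adj v y ↔ f v y = 1 := by simp [H, hv, hy]
      simp only [hv, if_true, h5]; split_ifs <;> omega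
    · have h5 : H.Adj v y ↔ f y v = 1 := by simp [H, hv, hy]
      simp only [hv, if_false, h5]; split_ifs <;> omega
    · have h4 := hsame v y (by tauto)
      have h5 : ¬ H.Adj v y := by simp [H, hv, hy]
      rw [if_neg hv, if_neg h5]; omega
  have hdvd : 2 * ((2 * k : ℕ) : ℤ) ∣ 2 * Nat.card (H.neighborSet v) - 2 * k := by
    have h1 := hfβ v (mem_univ v)
    simp only [hdiff, cutDemand, Pi.zero_apply] at h1
    rw [hcard]
    by_cases hv : v ∈ T
    · simp only [hv, if_true, sum_sub_distrib, ← mul_sum] at h1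
      convert h1 using 1
      ring
    · simp only [hv, if_false, sum_sub_distrib, ← mul_sum] at h1
      convert Int.dvd_neg.2 h1 using 1
      ring
  obtain ⟨c, hc⟩ := hdvd
  push_cast at hc
  have h1 : (Nat.card (H.neighborSet v) : ℤ) = k + 2 * k * c := by linarith
  zify
  rw [h1, Int.add_mul_emod_self_left]
  exact Int.emod_eq_of_lt (by omega) (by omega)

end MaxCut

theorem thomassen_mod_k_factor (k : ℕ) (hk : 1 ≤ k)
    {V : Type*} [Fintype V] (G : SimpleGraph V)
    (hconn : IsMEdgeConnected G (12 * k - 7)) (heven : Even (Fintype.card V)) :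
    ∃ H : SimpleGraph V, H ≤ G ∧
      ∀ v : V, Nat.card (H.neighborSet v) % (2 * k) = k := by
  classical
  obtain ⟨T, -, hT⟩ := Finset.exists_max_image (Finset.univ : Finset (Finset V))
    (fun T ↦ ∑ x, ∑ y, crossInd G T x y) Finset.univ_nonempty
  exact exists_subgraph_of_orientable hk ((admissible_crossInd hk hconn heven
    fun T' ↦ hT T' (Finset.mem_univ T')).orientable (by omega))
end

section
/- For every graph G, the edges of G can be partitioned into at most 4 classes such that each class spans a subgraph with all vertex degrees odd. -/
/-- The number of edges of `G` incident to `v` that receive color `i` under `c`. -/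
def colorDeg {V : Type*} [Fintype V] [DecidableEq V] (G : SimpleGraph V)
    [DecidableRel G.Adj] {m : ℕ} (c : Sym2 V → Fin m) (i : Fin m) (v : V) : ℕ :=
  ((G.incidenceFinset v).filter (fun e => c e = i)).card

namespace OddEdgeColoring

variable {V : Type*} [DecidableEq V]

/-- The number of edges in the edge set `s` that are incident to `v`. -/
def incDeg (s : Finset (Sym2 V)) (v : V) : ℕ := (s.filter (v ∈ ·)).card

/-- Every vertex covered by the edge set `s` has odd degree in `s`. -/
def IsOddEdgeSet (s : Finset (Sym2 V)) : Prop := ∀ v, incDeg s v = 0 ∨ Odd (incDeg s v)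

/-- Every nonempty subset of the edge set `s` has a vertex of degree one. -/
def IsForest (s : Finset (Sym2 V)) : Prop :=
  ∀ t ⊆ s, t.Nonempty → ∃ v e, t.filter (v ∈ ·) = {e}

theorem IsForest.mono {s t : Finset (Sym2 V)} (hs : IsForest s) (h : t ⊆ s) : IsForest t :=
  fun u hu => hs u (hu.trans h)

theorem IsForest.union_pendant {s r : Finset (Sym2 V)} (hs : IsForest s) {v : V}
    (hr : r.card ≤ 1) (hrv : ∀ e ∈ r, v ∈ e) (hsv : ∀ e ∈ s, v ∉ e) : IsForest (s ∪ r) := by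
  intro t ht hne
  by_cases h : ∃ e ∈ t, e ∈ r
  · obtain ⟨e, het, her⟩ := h
    refine ⟨v, e, ?_⟩
    ext f
    simp only [Finset.mem_filter, Finset.mem_singleton]
    constructor
    · rintro ⟨hf, hvf⟩
      rcases Finset.mem_union.1 (ht hf) with h | h
      · exact absurd hvf (hsv f h)
      · exact Finset.card_le_one.1 hr f h e her
    · rintro rfl
      exact ⟨het, hrv _ her⟩
  · push Not at h
    exact hs t (fun e he => (Finset.mem_union.1 (ht he)).resolve_right (h e he)) hne

theorem isForest_of_isAcyclic [Fintype V] {F : SimpleGraph V} (hF : F.IsAcyclic)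
    {s : Finset (Sym2 V)} (hs : ∀ e ∈ s, e ∈ F.edgeSet) : IsForest s := by
  classical
  intro t ht hne
  have hadj : ∀ u v, (SimpleGraph.fromEdgeSet (t : Set (Sym2 V))).Adj u v ↔ s(u, v) ∈ t := by
    intro u v
    simp only [SimpleGraph.fromEdgeSet_adj, Finset.mem_coe, and_iff_left_iff_imp]
    exact fun h => (show F.Adj u v from hs _ (ht h)).ne
  set T := SimpleGraph.fromEdgeSet (t : Set (Sym2 V)) with hT
  have hTF : T ≤ F := fun u v h => hs _ (ht ((hadj u v).1 h))
  obtain ⟨e, he⟩ := hne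
  induction e using Sym2.ind with | _ x y => ?_
  have hxy := (hadj x y).2 he
  let C := T.connectedComponentMk x
  have hy : y ∈ C := SimpleGraph.ConnectedComponent.sound hxy.symm.reachable
  have htree := (hF.anti hTF).isTree_connectedComponent C
  have : Nontrivial C :=
    ⟨⟨x, rfl⟩, ⟨y, hy⟩, fun h => hxy.ne (congrArg Subtype.val h)⟩
  obtain ⟨⟨v, hv⟩, hdeg⟩ := htree.exists_vert_degree_one_of_nontrivial
  rw [SimpleGraph.degree_eq_one_iff_existsUnique_adj] at hdeg
  obtain ⟨⟨w, hw⟩, hvw, huniq⟩ := hdeg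
  replace hvw : T.Adj v w := hvw
  refine ⟨v, s(v, w), ?_⟩
  ext f
  simp only [Finset.mem_filter, Finset.mem_singleton]
  constructor
  · rintro ⟨hf, hvf⟩
    obtain ⟨z, rfl⟩ := hvf
    have hvz := (hadj v z).2 hf
    have hz : z ∈ C := (SimpleGraph.ConnectedComponent.sound hvz.symm.reachable).trans hv
    have := huniq ⟨z, hz⟩ hvz
    rw [show z = w from congrArg Subtype.val this]
  · rintro rfl
    exact ⟨(hadj v w).1 hvw, by simp⟩

/-- The edges of a forest can be labelled in `ZMod 2` such that the labels agree around each vertex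
of `M` and sum to one around each other vertex of degree at least two. -/
theorem IsForest.exists_labelling {s : Finset (Sym2 V)} (hs : IsForest s) (M : Set V) :
    ∃ c : Sym2 V → ZMod 2, ∀ v,
      (v ∈ M → ∀ e ∈ s, ∀ f ∈ s, v ∈ e → v ∈ f → c e = c f) ∧
      (v ∉ M → 2 ≤ incDeg s v → ∑ e ∈ s with v ∈ e, c e = 1) := by
  induction hn : s.card generalizing s with
  | zero =>
    obtain rfl := Finset.card_eq_zero.1 hn
    exact ⟨0, fun v => ⟨by simp, by simp [incDeg]⟩⟩
  | succ n ih =>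
    obtain ⟨u, e, hue⟩ := hs s subset_rfl (Finset.card_pos.1 (by omega))
    obtain ⟨hes, hu⟩ := Finset.mem_filter.1 (hue ▸ Finset.mem_singleton_self e)
    obtain ⟨v, rfl⟩ := hu
    have huniq : ∀ f ∈ s, u ∈ f → f = s(u, v) := fun f hf huf => by
      have : f ∈ s.filter (u ∈ ·) := by simp [hf, huf]
      simpa [hue] using this
    obtain ⟨c, hc⟩ := ih (hs.mono (Finset.erase_subset s(u, v) s))
      (by rw [Finset.card_erase_of_mem hes]; omega)
    obtain ⟨a, haM, haS⟩ : ∃ a : ZMod 2,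
        (v ∈ M → ∀ f ∈ s.erase s(u, v), v ∈ f → c f = a) ∧
        (v ∉ M → ∑ f ∈ s.erase s(u, v) with v ∈ f, c f + a = 1) := by
      by_cases hv : v ∈ M
      · by_cases hf : ∃ f ∈ s.erase s(u, v), v ∈ f
        · obtain ⟨f, hf, hvf⟩ := hf
          exact ⟨c f, fun _ g hg hvg => (hc v).1 hv g hg f hf hvg hvf, fun h => absurd hv h⟩
        · push Not at hf
          exact ⟨0, fun _ f h h' => absurd h' (hf f h), fun h => absurd hv h⟩
      · exact ⟨1 - ∑ f ∈ s.erase s(u, v) with v ∈ f, c f, fun h => absurd h hv,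
          fun _ => by ring⟩
    refine ⟨Function.update c s(u, v) a, fun w => ?_⟩
    have hupd : ∀ f, f ≠ s(u, v) → Function.update c s(u, v) a f = c f := fun f hf =>
      Function.update_of_ne hf _ _
    by_cases hwu : w = u
    · subst hwu
      refine ⟨fun _ f hf g hg hwf hwg => by rw [huniq f hf hwf, huniq g hg hwg], fun _ h => ?_⟩
      simp [incDeg, hue] at h
    by_cases hwv : w = v
    · subst hwv
      refine ⟨fun hM => ?_, fun hM _ => ?_⟩
      · have key : ∀ f ∈ s, w ∈ f → Function.update c s(u, w) a f = a := by
          intro f hf hwf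
          by_cases h : f = s(u, w)
          · simp [h]
          · rw [hupd f h, haM hM f (Finset.mem_erase.2 ⟨h, hf⟩) hwf]
        intro f hf g hg hwf hwg
        rw [key f hf hwf, key g hg hwg]
      · rw [← haS hM, ← Finset.insert_erase hes, Finset.filter_insert, if_pos (by simp),
          Finset.sum_insert (by simp), Finset.erase_insert (by simp), add_comm]
        simp only [Function.update_self]
        congr 1
        refine Finset.sum_congr rfl fun f hf => hupd f ?_
        simp only [Finset.mem_filter, Finset.mem_erase] at hf
        exact hf.1.1
    · have hw : ∀ f, w ∈ f → f ≠ s(u, v) := by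
        rintro f hf rfl
        simp [hwu, hwv] at hf
      have hfil : (s.erase s(u, v)).filter (w ∈ ·) = s.filter (w ∈ ·) := by
        ext f
        simp only [Finset.mem_filter, Finset.mem_erase]
        exact ⟨fun h => ⟨h.1.2, h.2⟩, fun h => ⟨⟨hw f h.2, h.1⟩, h.2⟩⟩
      refine ⟨fun hM f hf g hg hwf hwg => ?_, fun hM h => ?_⟩
      · rw [hupd f (hw f hwf), hupd g (hw g hwg)]
        exact (hc w).1 hM f (Finset.mem_erase.2 ⟨hw f hwf, hf⟩) g
          (Finset.mem_erase.2 ⟨hw g hwg, hg⟩) hwf hwg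
      · rw [← (hc w).2 hM (by rwa [incDeg, hfil]), hfil]
        exact Finset.sum_congr rfl fun f hf => hupd f (hw f (Finset.mem_filter.1 hf).2)

theorem incDeg_eq_add (s : Finset (Sym2 V)) (c : Sym2 V → ZMod 2) (v : V) :
    incDeg s v = incDeg (s.filter (c · = 0)) v + incDeg (s.filter (¬ c · = 0)) v := by
  simp only [incDeg, Finset.filter_filter]
  rw [← Finset.card_filter_add_card_filter_not (s := s.filter (v ∈ ·)) (c · = 0)]
  simp only [Finset.filter_filter, and_comm]

theorem natCast_incDeg_filter_ne_zero (s : Finset (Sym2 V)) (c : Sym2 V → ZMod 2) (v : V) :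
    (incDeg (s.filter (¬ c · = 0)) v : ZMod 2) = ∑ e ∈ s with v ∈ e, c e := by
  have h01 : ∀ x : ZMod 2, (if x = 0 then 0 else 1 : ZMod 2) = x := by decide
  rw [incDeg, Finset.filter_filter, Finset.card_filter, Finset.sum_filter]
  push_cast
  refine Finset.sum_congr rfl fun e _ => ?_
  have := h01 (c e)
  by_cases hv : v ∈ e <;> by_cases hc : c e = 0 <;> simp_all

theorem IsForest.exists_two_odd {s : Finset (Sym2 V)} (hs : IsForest s) :
    ∃ c : Sym2 V → ZMod 2, IsOddEdgeSet (s.filter (c · = 0)) ∧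
      IsOddEdgeSet (s.filter (¬ c · = 0)) := by
  obtain ⟨c, hc⟩ := hs.exists_labelling {v | Odd (incDeg s v)}
  refine ⟨c, forall_and.1 fun v => ?_⟩
  have hadd := incDeg_eq_add s c v
  by_cases hv : Odd (incDeg s v)
  · have hone : incDeg (s.filter (c · = 0)) v = 0 ∨ incDeg (s.filter (¬ c · = 0)) v = 0 := by
      by_contra! h
      simp only [incDeg, Finset.card_ne_zero, Finset.filter_nonempty_iff, Finset.mem_filter] at h
      obtain ⟨⟨e, ⟨he, he0⟩, hve⟩, f, ⟨hf, hf0⟩, hvf⟩ := h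
      exact hf0 (((hc v).1 hv f hf e he hvf hve).trans he0)
    rcases hone with h | h
    · rw [h, zero_add] at hadd
      exact ⟨.inl h, .inr (hadd ▸ hv)⟩
    · rw [h, add_zero] at hadd
      exact ⟨.inr (hadd ▸ hv), .inl h⟩
  · by_cases h0 : incDeg s v = 0
    · exact ⟨.inl (by omega), .inl (by omega)⟩
    · have h2 : 2 ≤ incDeg s v := by
        rw [Nat.not_odd_iff_even] at hv
        obtain ⟨k, hk⟩ := hv
        omega
      have h := natCast_incDeg_filter_ne_zero s c v
      rw [(hc v).2 hv h2, ZMod.natCast_eq_one_iff_odd] at h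
      refine ⟨.inr ?_, .inr h⟩
      rw [Nat.not_odd_iff_even, hadd] at hv
      exact (Nat.even_add'.1 hv).2 h

/-- In a graph, a set of vertices that are pairwise reachable carries edge labellings with any
prescribed boundary of total weight zero. -/
theorem exists_boundary_eq [Fintype V] (T : SimpleGraph V) [DecidableRel T.Adj] (W : Finset V)
    (hW : ∀ u ∈ W, ∀ v ∈ W, T.Reachable u v) (f : V → ZMod 2) (hf : ∀ v ∉ W, f v = 0)
    (hsum : ∑ v ∈ W, f v = 0) :
    ∃ x : Sym2 V → ZMod 2, ∀ v, ∑ e ∈ T.edgeFinset with v ∈ e, x e = f v := by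
  let bd : (Sym2 V → ZMod 2) →ₗ[ZMod 2] (V → ZMod 2) :=
    { toFun := fun x v => ∑ e ∈ T.edgeFinset with v ∈ e, x e
      map_add' := fun x y => by ext v; simp [Finset.sum_add_distrib]
      map_smul' := fun a x => by ext v; simp [Finset.mul_sum] }
  have hadj : ∀ u v, T.Adj u v →
      (Pi.single u 1 + Pi.single v 1 : V → ZMod 2) ∈ LinearMap.range bd := by
    intro u v huv
    refine ⟨Pi.single s(u, v) 1, ?_⟩
    ext w
    change ∑ e ∈ T.edgeFinset with w ∈ e, (Pi.single s(u, v) 1 : Sym2 V → ZMod 2) e = _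
    simp only [Pi.single_apply, Finset.sum_ite_eq', Finset.mem_filter, Pi.add_apply]
    have := huv.ne
    by_cases hu : w = u
    · subst hu
      simp [huv, this]
    · by_cases hv : w = v
      · subst hv
        simp [huv, this.symm]
      · simp [hu, hv]
  have hchar : ∀ g : V → ZMod 2, g + g = 0 := fun g => by
    ext v
    exact CharTwo.add_self_eq_zero _
  have hreach : ∀ u v, T.Reachable u v →
      (Pi.single u 1 + Pi.single v 1 : V → ZMod 2) ∈ LinearMap.range bd := by
    rintro u v ⟨p⟩
    induction p with
    | nil =>
      rw [hchar]
      exact zero_mem _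
    | @cons u w v h p ih =>
      have := add_mem (hadj u w h) ih
      rwa [add_assoc, ← add_assoc (Pi.single w 1) (Pi.single w 1), hchar, zero_add] at this
  suffices hmem : f ∈ LinearMap.range bd by
    obtain ⟨x, hx⟩ := hmem
    exact ⟨x, fun v => congrFun hx v⟩
  rcases W.eq_empty_or_nonempty with rfl | ⟨r, hr⟩
  · rw [show f = 0 from funext fun v => hf v (by simp)]
    exact zero_mem _
  · have hfsum : f = ∑ v ∈ W, f v • (Pi.single v 1 + Pi.single r 1 : V → ZMod 2) := by
      simp only [smul_add, Finset.sum_add_distrib, ← Finset.sum_smul, hsum, zero_smul, add_zero]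
      ext w
      by_cases hw : w ∈ W
      · simp [Finset.sum_apply, Pi.single_apply, hw]
      · simp [Finset.sum_apply, Pi.single_apply, hw, hf w hw]
    rw [hfsum]
    exact sum_mem fun v hv => Submodule.smul_mem _ _ (hreach v r (hW v hv r hr))

theorem sum_incDeg [Fintype V] (s : Finset (Sym2 V)) (hs : ∀ e ∈ s, ¬ e.IsDiag) :
    ∑ v, (incDeg s v : ZMod 2) = 0 := by
  simp only [incDeg, Finset.card_filter, Nat.cast_sum]
  rw [Finset.sum_comm]
  refine Finset.sum_eq_zero fun e he => ?_
  rw [← Nat.cast_sum, ← Finset.card_filter]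
  have := Sym2.card_toFinset_of_not_isDiag e (hs e he)
  rw [show Finset.univ.filter (· ∈ e) = e.toFinset by ext; simp, this]
  rfl

theorem isOddEdgeSet_star {s : Finset (Sym2 V)} {v : V} (hs : ∀ e ∈ s, v ∈ e)
    (hcard : s.card = 0 ∨ Odd s.card) : IsOddEdgeSet s := by
  intro u
  by_cases huv : u = v
  · subst huv
    rwa [incDeg, Finset.filter_true_of_mem hs]
  · have hle : incDeg s u ≤ 1 := by
      refine Finset.card_le_one.2 fun e he f hf => ?_
      simp only [Finset.mem_filter] at he hf
      rw [(Sym2.mem_and_mem_iff huv).1 ⟨he.2, hs e he.1⟩,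
        (Sym2.mem_and_mem_iff huv).1 ⟨hf.2, hs f hf.1⟩]
    rcases Nat.le_one_iff_eq_zero_or_eq_one.1 hle with h | h
    · exact .inl h
    · exact .inr (h ▸ odd_one)

theorem exists_subset_card_odd {α : Type*} [DecidableEq α] (s : Finset α) :
    ∃ t ⊆ s, (t.card = 0 ∨ Odd t.card) ∧ (s \ t).card ≤ 1 := by
  by_cases hs : s.card = 0 ∨ Odd s.card
  · exact ⟨s, subset_rfl, hs, by simp⟩
  · push Not at hs
    obtain ⟨a, ha⟩ := Finset.card_ne_zero.1 hs.1
    refine ⟨s.erase a, Finset.erase_subset a s, .inr ?_, ?_⟩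
    · have h := hs.2
      rw [Nat.not_odd_iff_even, ← Finset.card_erase_add_one ha, Nat.even_add_one,
        Nat.not_even_iff_odd] at h
      exact h
    · rw [Finset.sdiff_erase_self ha, Finset.card_singleton]

section Induced

variable [Fintype V] (G : SimpleGraph V) [DecidableRel G.Adj]

/-- The edges of `G` with both ends in `W`. -/
def edgesIn (W : Finset V) : Finset (Sym2 V) := G.edgeFinset.filter fun e => ∀ v ∈ e, v ∈ W

/-- If `G` is connected on an even set `W` of vertices, then removing some odd edge set
from the edges inside `W` leaves a forest. -/
theorem exists_odd_union_forest (W : Finset V) (hW : (G.induce (W : Set V)).Preconnected)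
    (heven : Even W.card) :
    ∃ H ⊆ edgesIn G W, IsOddEdgeSet H ∧ IsForest (edgesIn G W \ H) := by
  classical
  set K := (G.induce (W : Set V)).spanningCoe with hK
  obtain ⟨T, hTK, hT, hreach⟩ := K.exists_isAcyclic_reachable_eq_le
  have hTW : ∀ e ∈ T.edgeSet, e ∈ edgesIn G W := by
    intro e
    induction e using Sym2.ind with | _ x y => ?_
    intro he
    have : K.Adj x y := hTK he
    simp only [hK, SimpleGraph.map_adj, SimpleGraph.comap_adj] at this
    obtain ⟨⟨a, ha⟩, ⟨b, hb⟩, hab, rfl, rfl⟩ := this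
    simp only [edgesIn, Finset.mem_filter, SimpleGraph.mem_edgeFinset]
    refine ⟨hab, ?_⟩
    simpa using And.intro ha hb
  have hTreach : ∀ u ∈ W, ∀ v ∈ W, T.Reachable u v := by
    intro u hu v hv
    rw [hreach]
    exact (hW ⟨u, hu⟩ ⟨v, hv⟩).map
      (⟨Subtype.val, fun {a b} h => SimpleGraph.map_adj_apply.2 h⟩ : G.induce (W : Set V) →g K)
  set N := edgesIn G W \ T.edgeFinset with hN
  have hoff : ∀ s ⊆ edgesIn G W, ∀ v ∉ W, incDeg s v = 0 := by
    intro s hs v hv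
    rw [incDeg, Finset.card_eq_zero, Finset.filter_eq_empty_iff]
    exact fun e he hve => hv ((Finset.mem_filter.1 (hs he)).2 v hve)
  have hNsub : N ⊆ edgesIn G W := Finset.sdiff_subset
  let f : V → ZMod 2 := fun v => if v ∈ W then 1 + incDeg N v else 0
  have hfsum : ∑ v ∈ W, f v = 0 := by
    have hNW : ∑ v ∈ W, (incDeg N v : ZMod 2) = ∑ v, (incDeg N v : ZMod 2) :=
      Finset.sum_subset (Finset.subset_univ W) fun v _ hv => by simp [hoff N hNsub v hv]
    rw [Finset.sum_congr rfl fun v hv => if_pos hv, Finset.sum_add_distrib, hNW,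
      sum_incDeg N fun e he => G.not_isDiag_of_mem_edgeSet
        (SimpleGraph.mem_edgeFinset.1 (Finset.mem_filter.1 (hNsub he)).1), add_zero]
    simpa [ZMod.natCast_eq_zero_iff_even] using heven
  obtain ⟨x, hx⟩ := exists_boundary_eq T W hTreach f (fun v hv => if_neg hv) hfsum
  set J := T.edgeFinset.filter (¬ x · = 0) with hJ
  have hJsub : J ⊆ edgesIn G W := fun e he =>
    hTW e (SimpleGraph.mem_edgeFinset.1 (Finset.mem_filter.1 he).1)
  refine ⟨N ∪ J, Finset.union_subset hNsub hJsub, fun v => ?_, ?_⟩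
  · by_cases hv : v ∈ W
    · right
      have hdisj : Disjoint N J := by
        rw [Finset.disjoint_left]
        exact fun e he he' => (Finset.mem_sdiff.1 he).2 (Finset.mem_filter.1 he').1
      have hadd : incDeg (N ∪ J) v = incDeg N v + incDeg J v := by
        rw [incDeg, Finset.filter_union, Finset.card_union_of_disjoint
          (Finset.disjoint_filter_filter hdisj)]
        rfl
      rw [← ZMod.natCast_eq_one_iff_odd, hadd, Nat.cast_add, hJ,
        natCast_incDeg_filter_ne_zero, hx v, show f v = 1 + incDeg N v from if_pos hv,
        add_left_comm, CharTwo.add_self_eq_zero, add_zero]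
    · exact .inl (hoff _ (Finset.union_subset hNsub hJsub) v hv)
  · refine isForest_of_isAcyclic hT fun e he => ?_
    by_contra h
    simp only [hN, Finset.mem_sdiff, Finset.mem_union, SimpleGraph.mem_edgeFinset] at he
    exact he.2 (.inl ⟨he.1, h⟩)

/-- If `G` is connected on `W`, then the edges inside `W` are partitioned into two odd edge sets
and a forest. -/
theorem exists_two_odd_union_forest (W : Finset V) (hW : (G.induce (W : Set V)).Connected) :
    ∃ H ⊆ edgesIn G W, ∃ S ⊆ edgesIn G W, Disjoint H S ∧ IsOddEdgeSet H ∧ IsOddEdgeSet S ∧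
      IsForest (edgesIn G W \ (H ∪ S)) := by
  rcases Nat.even_or_odd W.card with heven | hodd
  · obtain ⟨H, hH, hHodd, hF⟩ := exists_odd_union_forest G W hW.preconnected heven
    exact ⟨H, hH, ∅, by simp, by simp, hHodd, fun v => .inl (by simp [incDeg]), by simpa using hF⟩
  obtain ⟨⟨v, hv⟩, hconn⟩ := hW.exists_preconnected_induce_compl_singleton_of_finite
  have hconn' : (G.induce ((W.erase v : Finset V) : Set V)).Preconnected := by
    rintro ⟨a, ha⟩ ⟨b, hb⟩
    have ha' := Finset.mem_erase.1 ha
    have hb' := Finset.mem_erase.1 hb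
    let φ : (G.induce (W : Set V)).induce {⟨v, hv⟩}ᶜ →g
        G.induce ((W.erase v : Finset V) : Set V) :=
      { toFun := fun z => ⟨z.1.1, Finset.mem_erase.2 ⟨fun h => z.2 (Subtype.ext h), z.1.2⟩⟩
        map_rel' := fun h => h }
    exact (hconn ⟨⟨a, ha'.2⟩, fun h => ha'.1 (congrArg Subtype.val h)⟩
      ⟨⟨b, hb'.2⟩, fun h => hb'.1 (congrArg Subtype.val h)⟩).map φ
  obtain ⟨H, hH, hHodd, hF⟩ := exists_odd_union_forest G (W.erase v) hconn' (by
    rw [Finset.card_erase_of_mem hv]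
    exact hodd.tsub_odd odd_one)
  have hsub : ∀ e, e ∈ edgesIn G (W.erase v) ↔ e ∈ edgesIn G W ∧ v ∉ e := by
    intro e
    simp only [edgesIn, Finset.mem_filter, Finset.mem_erase]
    exact ⟨fun h => ⟨⟨h.1, fun u hu => (h.2 u hu).2⟩, fun hve => (h.2 v hve).1 rfl⟩,
      fun h => ⟨h.1.1, fun u hu => ⟨fun huv => h.2 (huv ▸ hu), h.1.2 u hu⟩⟩⟩
  obtain ⟨S, hS, hScard, hrest⟩ := exists_subset_card_odd ((edgesIn G W).filter (v ∈ ·))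
  have hSv : ∀ e ∈ S, v ∈ e := fun e he => (Finset.mem_filter.1 (hS he)).2
  refine ⟨H, fun e he => ((hsub e).1 (hH he)).1, S, hS.trans (Finset.filter_subset _ _), ?_, hHodd,
    isOddEdgeSet_star hSv hScard, ?_⟩
  · rw [Finset.disjoint_left]
    exact fun e he he' => ((hsub e).1 (hH he)).2 (hSv e he')
  · refine (hF.union_pendant hrest (v := v)
      (fun e he => (Finset.mem_filter.1 (Finset.mem_sdiff.1 he).1).2)
      (fun e he => ((hsub e).1 (Finset.mem_sdiff.1 he).1).2)).mono fun e he => ?_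
    simp only [Finset.mem_sdiff, Finset.mem_union, Finset.mem_filter, hsub] at he ⊢
    tauto

theorem exists_four_coloring_of_connected (W : Finset V)
    (hW : (G.induce (W : Set V)).Connected) :
    ∃ c : Sym2 V → Fin 4, ∀ i, IsOddEdgeSet ((edgesIn G W).filter (c · = i)) := by
  obtain ⟨H, hH, S, hS, hdisj, hHodd, hSodd, hF⟩ := exists_two_odd_union_forest G W hW
  obtain ⟨b, hb0, hb1⟩ := hF.exists_two_odd
  rw [Finset.disjoint_left] at hdisj
  refine ⟨fun e => if e ∈ H then 2 else if e ∈ S then 3 else if b e = 0 then 0 else 1,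
    fun i => ?_⟩
  fin_cases i
  · convert hb0 using 1
    ext e
    simp only [Finset.mem_filter, Finset.mem_sdiff, Finset.mem_union]
    split_ifs <;> simp_all
  · convert hb1 using 1
    ext e
    simp only [Finset.mem_filter, Finset.mem_sdiff, Finset.mem_union]
    split_ifs <;> simp_all
  · convert hHodd using 1
    ext e
    have := @hH e
    simp only [Finset.mem_filter]
    split_ifs <;> simp_all
  · convert hSodd using 1
    ext e
    have := @hS e
    have := @hdisj e
    simp only [Finset.mem_filter]
    split_ifs <;> simp_all

end Induced

end OddEdgeColoring

open OddEdgeColoring in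
theorem pyber_four_odd_subgraphs {V : Type*} [Fintype V] [DecidableEq V]
    (G : SimpleGraph V) [DecidableRel G.Adj] :
    ∃ c : Sym2 V → Fin 4, ∀ (i : Fin 4) (v : V),
      colorDeg G c i v = 0 ∨ Odd (colorDeg G c i v) := by
  classical
  have hcomp : ∀ C : G.ConnectedComponent, ∃ c : Sym2 V → Fin 4,
      ∀ i, IsOddEdgeSet ((edgesIn G C.supp.toFinset).filter (c · = i)) := fun C =>
    exists_four_coloring_of_connected G _ (by
      rw [Set.coe_toFinset]
      exact C.connected_toSimpleGraph)
  choose c hc using hcomp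
  refine ⟨fun e => c (G.connectedComponentMk e.out.1) e, fun i v => ?_⟩
  have hadj : ∀ e ∈ G.edgeSet, v ∈ e → ∀ u ∈ e,
      G.connectedComponentMk u = G.connectedComponentMk v := by
    rintro e he ⟨w, rfl⟩ u hu
    rcases Sym2.mem_iff.1 hu with rfl | rfl
    · rfl
    · exact SimpleGraph.ConnectedComponent.sound (SimpleGraph.Adj.reachable he).symm
  have key : colorDeg G (fun e => c (G.connectedComponentMk e.out.1) e) i v =
      incDeg ((edgesIn G (G.connectedComponentMk v).supp.toFinset).filter
        (c (G.connectedComponentMk v) · = i)) v := by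
    rw [colorDeg, incDeg, SimpleGraph.incidenceFinset_eq_filter]
    congr 1
    ext e
    simp only [edgesIn, Finset.mem_filter, SimpleGraph.mem_edgeFinset, Set.mem_toFinset,
      SimpleGraph.ConnectedComponent.mem_supp_iff]
    constructor
    · rintro ⟨⟨he, hve⟩, hce⟩
      rw [hadj e he hve _ (Sym2.out_fst_mem e)] at hce
      exact ⟨⟨⟨he, hadj e he hve⟩, hce⟩, hve⟩
    · rintro ⟨⟨⟨he, -⟩, hce⟩, hve⟩
      rw [hadj e he hve _ (Sym2.out_fst_mem e)]
      exact ⟨⟨he, hve⟩, hce⟩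
  rw [key]
  exact hc _ i v
end
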